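/- arXiv:1610.07320 — 2 statements merged into one kernel-verified Lean document; each statement's English description precedes it below -/
import Mathlib

section
/- Fix λ > 1, let G = G(n, λ/n) be the Erdős–Rényi random graph, and let X_0 be an independent uniformly random 3-coloring of its vertices. Then there exists a constant D = D(λ) > 0 such that for all sufficiently large n, the probability that the 3-color CCA trajectory oscillates (has activity α > 0) on the largest connected component of G is at least 1 − e^{−Dn}. -/
noncomputable section
attribute [local instance] Classical.propDecidable

open Filter MeasureTheory

/-- One step of the 3-color cyclic cellular automaton. -/
def ccaStep {V : Type*} (G : SimpleGraph V) (X : V → ZMod 3) : V → ZMod 3 :=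
  fun v => if ∃ u, G.Adj v u ∧ X u = X v + 1 then X v + 1 else X v

/-- The CCA trajectory started from `X₀`. -/
def ccaTraj {V : Type*} (G : SimpleGraph V) (X₀ : V → ZMod 3) : ℕ → V → ZMod 3 :=
  fun t => (ccaStep G)^[t] X₀

/-- A vertex is excited at time `t` for CCA iff its color advances. -/
def ccaExcited {V : Type*} (G : SimpleGraph V) (X₀ : V → ZMod 3) (t : ℕ) (v : V) : Prop :=
  ccaTraj G X₀ (t + 1) v = ccaTraj G X₀ t v + 1

/-- Number of excitations of `x` at times `0, …, t-1` (CCA). -/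
def ccaNe {V : Type*} (G : SimpleGraph V) (X₀ : V → ZMod 3) (t : ℕ) (x : V) : ℕ :=
  ((Finset.range t).filter fun s => ccaExcited G X₀ s x).card

/-- The random graph on `Fin n` determined by the edge indicators `ω`. -/
def erGraph (n : ℕ) (ω : Sym2 (Fin n) → Bool) : SimpleGraph (Fin n) :=
  SimpleGraph.fromEdgeSet {e : Sym2 (Fin n) | ω e = true}

/-! ### Deterministic part: no activity implies a lift -/

def dz (a : ZMod 3) : ℤ := if a = 0 then 0 else if a = 1 then 1 else -1

def ei {V : Type*} (G : SimpleGraph V) (X₀ : V → ZMod 3) (t : ℕ) (v : V) : ℕ :=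
  if ccaExcited G X₀ t v then 1 else 0

theorem zmod3_cases (a : ZMod 3) : a = 0 ∨ a = 1 ∨ a = -1 := by
  fin_cases a
  · left; rfl
  · right; left; rfl
  · right; right; rfl

theorem z3_one_ne_zero : (1 : ZMod 3) ≠ 0 := by intro h; cases h
theorem z3_neg_one_ne_zero : (-1 : ZMod 3) ≠ 0 := by intro h; cases h
theorem z3_neg_one_ne_one : (-1 : ZMod 3) ≠ 1 := by intro h; cases h
theorem z3_two : (1 : ZMod 3) + 1 = -1 := rfl

theorem dz_zero : dz 0 = 0 := by simp [dz]
theorem dz_one : dz 1 = 1 := by simp [dz, z3_one_ne_zero]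
theorem dz_neg_one : dz (-1) = -1 := by
  unfold dz; rw [if_neg z3_neg_one_ne_zero, if_neg z3_neg_one_ne_one]

theorem dz_abs (a : ZMod 3) : |dz a| ≤ 1 := by
  rcases zmod3_cases a with rfl | rfl | rfl
  · simp [dz_zero]
  · simp [dz_one]
  · simp [dz_neg_one]

theorem ccaTraj_succ {V : Type*} (G : SimpleGraph V) (X₀ : V → ZMod 3) (t : ℕ) :
    ccaTraj G X₀ (t + 1) = ccaStep G (ccaTraj G X₀ t) := by
  unfold ccaTraj
  exact Function.iterate_succ_apply' _ _ _

theorem excited_iff {V : Type*} (G : SimpleGraph V) (X₀ : V → ZMod 3) (t : ℕ) (v : V) :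
    ccaExcited G X₀ t v ↔ ∃ u, G.Adj v u ∧ ccaTraj G X₀ t u = ccaTraj G X₀ t v + 1 := by
  unfold ccaExcited
  rw [ccaTraj_succ]
  unfold ccaStep
  split_ifs with h
  · simp [h]
  · simp only [h, iff_false]
    intro h'
    have : (1 : ZMod 3) = 0 := by
      simpa using h'.symm
    exact z3_one_ne_zero this

theorem ccaTraj_succ_ei {V : Type*} (G : SimpleGraph V) (X₀ : V → ZMod 3) (t : ℕ) (v : V) :
    ccaTraj G X₀ (t + 1) v = ccaTraj G X₀ t v + (ei G X₀ t v : ZMod 3) := by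
  unfold ei
  by_cases h : ccaExcited G X₀ t v
  · rw [if_pos h]; simpa [ccaExcited] using h
  · rw [if_neg h]
    rw [excited_iff] at h
    rw [ccaTraj_succ]
    unfold ccaStep
    rw [if_neg h]; simp

theorem ccaNe_zero {V : Type*} (G : SimpleGraph V) (X₀ : V → ZMod 3) (v : V) :
    ccaNe G X₀ 0 v = 0 := by simp [ccaNe]

theorem ccaNe_succ {V : Type*} (G : SimpleGraph V) (X₀ : V → ZMod 3) (t : ℕ) (v : V) :
    ccaNe G X₀ (t + 1) v = ccaNe G X₀ t v + ei G X₀ t v := by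
  unfold ccaNe ei
  rw [Finset.range_add_one, Finset.filter_insert]
  split_ifs with h
  · rw [Finset.card_insert_of_notMem (by simp)]
  · simp

theorem traj_eq_ne {V : Type*} (G : SimpleGraph V) (X₀ : V → ZMod 3) (t : ℕ) (v : V) :
    ccaTraj G X₀ t v = X₀ v + (ccaNe G X₀ t v : ZMod 3) := by
  induction t with
  | zero => simp [ccaNe_zero, ccaTraj]
  | succ t ih => rw [ccaTraj_succ_ei, ih, ccaNe_succ]; push_cast; ring

theorem dz_step {V : Type*} (G : SimpleGraph V) (X₀ : V → ZMod 3) (t : ℕ) (u v : V)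
    (huv : G.Adj u v) :
    dz (ccaTraj G X₀ (t + 1) v - ccaTraj G X₀ (t + 1) u) =
      dz (ccaTraj G X₀ t v - ccaTraj G X₀ t u) + ei G X₀ t v - ei G X₀ t u := by
  rw [ccaTraj_succ_ei, ccaTraj_succ_ei]
  have h1 : ccaTraj G X₀ t v - ccaTraj G X₀ t u = 1 → ei G X₀ t u = 1 := by
    intro h
    unfold ei
    rw [if_pos]
    rw [excited_iff]
    exact ⟨v, huv, by rw [← h]; ring⟩
  have h2 : ccaTraj G X₀ t v - ccaTraj G X₀ t u = -1 → ei G X₀ t v = 1 := by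
    intro h
    unfold ei
    rw [if_pos]
    rw [excited_iff]
    refine ⟨u, huv.symm, ?_⟩
    have : (1 : ZMod 3) = -(ccaTraj G X₀ t v - ccaTraj G X₀ t u) := by rw [h]; ring
    rw [this]; ring
  have e1 : ei G X₀ t u = 0 ∨ ei G X₀ t u = 1 := by unfold ei; split_ifs <;> simp
  have e2 : ei G X₀ t v = 0 ∨ ei G X₀ t v = 1 := by unfold ei; split_ifs <;> simp
  have key : ccaTraj G X₀ t v + (ei G X₀ t v : ZMod 3) - (ccaTraj G X₀ t u + (ei G X₀ t u : ZMod 3))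
    = (ccaTraj G X₀ t v - ccaTraj G X₀ t u) + (ei G X₀ t v : ZMod 3) - (ei G X₀ t u : ZMod 3) := by
    ring
  rw [key]
  generalize ccaTraj G X₀ t v - ccaTraj G X₀ t u = a at *
  rcases zmod3_cases a with rfl | rfl | rfl
  · rcases e1 with e1 | e1 <;> rcases e2 with e2 | e2 <;>
      simp [e1, e2, dz_zero, dz_one, dz_neg_one]
  · rw [h1 rfl]
    rcases e2 with e2 | e2 <;> simp [e2, dz_zero, dz_one]
  · rw [h2 rfl]
    rcases e1 with e1 | e1 <;> simp [e1, dz_zero, dz_neg_one]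

theorem dz_ne {V : Type*} (G : SimpleGraph V) (X₀ : V → ZMod 3) (t : ℕ) (u v : V)
    (huv : G.Adj u v) :
    dz (ccaTraj G X₀ t v - ccaTraj G X₀ t u) =
      dz (X₀ v - X₀ u) + ccaNe G X₀ t v - ccaNe G X₀ t u := by
  induction t with
  | zero => simp [ccaNe_zero, ccaTraj]
  | succ t ih =>
    rw [dz_step G X₀ t u v huv, ih, ccaNe_succ, ccaNe_succ]
    push_cast; ring

theorem ne_adj_le {V : Type*} (G : SimpleGraph V) (X₀ : V → ZMod 3) (t : ℕ) (u v : V)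
    (huv : G.Adj u v) : ccaNe G X₀ t v ≤ ccaNe G X₀ t u + 2 := by
  have h := dz_ne G X₀ t u v huv
  have h1 := abs_le.1 (dz_abs (ccaTraj G X₀ t v - ccaTraj G X₀ t u))
  have h2 := abs_le.1 (dz_abs (X₀ v - X₀ u))
  omega

theorem ne_reach_le {V : Type*} (G : SimpleGraph V) (X₀ : V → ZMod 3) (x v : V)
    (h : G.Reachable x v) : ∃ M : ℕ, ∀ t, ccaNe G X₀ t v ≤ ccaNe G X₀ t x + M := by
  obtain ⟨w⟩ := h
  induction w with
  | nil => exact ⟨0, fun t => by simp⟩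
  | cons hadj w ih =>
    obtain ⟨M, hM⟩ := ih
    refine ⟨M + 2, fun t => ?_⟩
    have := ne_adj_le G X₀ t _ _ hadj
    have := hM t
    omega

theorem ne_le {V : Type*} (G : SimpleGraph V) (X₀ : V → ZMod 3) (t : ℕ) (v : V) :
    ccaNe G X₀ t v ≤ t := by
  unfold ccaNe
  exact (Finset.card_filter_le _ _).trans (by simp)

theorem limsup_pos_of_active {V : Type*} [Fintype V] (G : SimpleGraph V) (X₀ : V → ZMod 3) (x : V)
    (h : ∀ t, ∃ v, G.Reachable x v ∧ ccaExcited G X₀ t v) :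
    0 < limsup (fun t : ℕ => (ccaNe G X₀ t x : ℝ) / t) atTop := by
  have hM : ∃ M : ℕ, ∀ v, G.Reachable x v → ∀ t, ccaNe G X₀ t v ≤ ccaNe G X₀ t x + M := by
    have : ∀ v, ∃ M : ℕ, G.Reachable x v → ∀ t, ccaNe G X₀ t v ≤ ccaNe G X₀ t x + M := by
      intro v
      by_cases hv : G.Reachable x v
      · obtain ⟨M, hM⟩ := ne_reach_le G X₀ x v hv
        exact ⟨M, fun _ => hM⟩
      · exact ⟨0, fun h => absurd h hv⟩
    choose M hM using this
    refine ⟨∑ v, M v, fun v hv t => (hM v hv t).trans ?_⟩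
    have : M v ≤ ∑ v, M v := Finset.single_le_sum (f := M) (fun _ _ => Nat.zero_le _) (Finset.mem_univ v)
    omega
  obtain ⟨M, hM⟩ := hM
  set C := Finset.univ.filter (fun v => G.Reachable x v) with hC
  have hsum : ∀ t, t ≤ ∑ v ∈ C, ccaNe G X₀ t v := by
    intro t
    induction t with
    | zero => simp
    | succ t ih =>
      have : ∑ v ∈ C, ccaNe G X₀ (t+1) v = ∑ v ∈ C, ccaNe G X₀ t v + ∑ v ∈ C, ei G X₀ t v := by
        rw [← Finset.sum_add_distrib]
        exact Finset.sum_congr rfl fun v _ => ccaNe_succ G X₀ t v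
      rw [this]
      obtain ⟨v, hv, he⟩ := h t
      have h1 : ei G X₀ t v ≤ ∑ v ∈ C, ei G X₀ t v :=
        Finset.single_le_sum (f := fun v => ei G X₀ t v) (fun _ _ => Nat.zero_le _) (by simp [hC, hv])
      have h2 : ei G X₀ t v = 1 := by unfold ei; rw [if_pos he]
      omega
  have hb : ∀ t, t ≤ C.card * (ccaNe G X₀ t x + M) := by
    intro t
    refine (hsum t).trans ?_
    have := Finset.sum_le_card_nsmul C (fun v => ccaNe G X₀ t v) (ccaNe G X₀ t x + M)
      (fun v hv => hM v (by simpa [hC] using hv) t)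
    simpa using this
  set K := C.card with hK
  have hKpos : 0 < K := by
    by_contra h0
    have h0' : K = 0 := by omega
    have := hb 1
    rw [h0'] at this
    omega
  have hKr : (0 : ℝ) < K := by exact_mod_cast hKpos
  have hev : ∀ᶠ t : ℕ in atTop, 1 / (2 * (K : ℝ)) ≤ (ccaNe G X₀ t x : ℝ) / t := by
    filter_upwards [eventually_ge_atTop (2 * K * M + 1)] with t ht
    have htr : (2 * K * M + 1 : ℝ) ≤ t := by exact_mod_cast ht
    have hbr : (t : ℝ) ≤ K * (ccaNe G X₀ t x + M) := by exact_mod_cast hb t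
    have htp : (0 : ℝ) < t := by
      have : (0:ℝ) ≤ 2 * K * M := by positivity
      linarith
    rw [div_le_div_iff₀ (by positivity) htp]
    nlinarith
  have hbdd : IsBoundedUnder (· ≤ ·) atTop (fun t : ℕ => (ccaNe G X₀ t x : ℝ) / t) := by
    refine ⟨1, ?_⟩
    simp only [eventually_map]
    filter_upwards with t
    apply div_le_one_of_le₀
    · exact_mod_cast ne_le G X₀ t x
    · positivity
  have := le_limsup_of_frequently_le hev.frequently hbdd
  have h3 : (0 : ℝ) < 1 / (2 * (K : ℝ)) := by positivity
  linarith

theorem exists_lift {V : Type*} [Fintype V] (G : SimpleGraph V) (X₀ : V → ZMod 3) (x : V)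
    (h : ¬ 0 < limsup (fun t : ℕ => (ccaNe G X₀ t x : ℝ) / t) atTop) :
    ∃ f : V → ℤ, (∀ v, G.Reachable x v → (f v : ZMod 3) = X₀ v) ∧
      ∀ u v, G.Reachable x u → G.Adj u v → |f v - f u| ≤ 1 := by
  have h' : ∃ t, ∀ v, G.Reachable x v → ¬ ccaExcited G X₀ t v := by
    by_contra hc
    push Not at hc
    exact h (limsup_pos_of_active G X₀ x hc)
  obtain ⟨t, ht⟩ := h'
  have hconst : ∀ u v, G.Reachable x u → G.Adj u v → ccaTraj G X₀ t v = ccaTraj G X₀ t u := by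
    intro u v hu huv
    have hv : G.Reachable x v := hu.trans huv.reachable
    have h1 := ht u hu
    have h2 := ht v hv
    rw [excited_iff] at h1 h2
    rcases zmod3_cases (ccaTraj G X₀ t v - ccaTraj G X₀ t u) with h | h | h
    · exact sub_eq_zero.1 h
    · exact absurd ⟨v, huv, by rw [← h]; ring⟩ h1
    · refine absurd ⟨u, huv.symm, ?_⟩ h2
      have : (1 : ZMod 3) = -(ccaTraj G X₀ t v - ccaTraj G X₀ t u) := by rw [h]; ring
      rw [this]; ring
  have hc2 : ∀ u v, G.Walk u v → G.Reachable x u → ccaTraj G X₀ t v = ccaTraj G X₀ t u := by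
    intro u v w
    induction w with
    | nil => intro _; rfl
    | cons hadj w ih =>
      intro hu
      rw [ih (hu.trans hadj.reachable), hconst _ _ hu hadj]
  refine ⟨fun v => ((ccaTraj G X₀ t x).val : ℤ) - ccaNe G X₀ t v, ?_, ?_⟩
  · intro v hv
    obtain ⟨w⟩ := hv
    have := hc2 _ _ w (SimpleGraph.Reachable.refl x)
    push_cast
    rw [ZMod.natCast_zmod_val, ← this, traj_eq_ne]
    ring
  · intro u v hu huv
    have h1 := dz_ne G X₀ t u v huv
    rw [hconst u v hu huv, sub_self, dz_zero] at h1
    have h2 := dz_abs (X₀ v - X₀ u)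
    rw [abs_le] at h2 ⊢
    constructor <;> linarith [h2.1, h2.2]

/-! ### Finite product Bernoulli weights -/

def bw (p : ℝ) (b : Bool) : ℝ := if b = true then p else 1 - p

def wt {ι : Type*} [Fintype ι] (p : ℝ) (ω : ι → Bool) : ℝ := ∏ e, bw p (ω e)

def Ex {ι : Type*} [Fintype ι] (p : ℝ) (f : (ι → Bool) → ℝ) : ℝ := ∑ ω, wt p ω * f ω

def ind (P : Prop) : ℝ := if P then 1 else 0

def Prb {ι : Type*} [Fintype ι] (p : ℝ) (E : (ι → Bool) → Prop) : ℝ := Ex p (fun ω => ind (E ω))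

theorem ind_nonneg (P : Prop) : 0 ≤ ind P := by unfold ind; split_ifs <;> norm_num
theorem ind_le_one (P : Prop) : ind P ≤ 1 := by unfold ind; split_ifs <;> norm_num
theorem ind_true {P : Prop} (h : P) : ind P = 1 := if_pos h
theorem ind_false {P : Prop} (h : ¬ P) : ind P = 0 := if_neg h
theorem ind_mono {P Q : Prop} (h : P → Q) : ind P ≤ ind Q := by
  by_cases hp : P
  · rw [ind_true hp, ind_true (h hp)]
  · rw [ind_false hp]; exact ind_nonneg _
theorem ind_and (P Q : Prop) : ind (P ∧ Q) = ind P * ind Q := by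
  unfold ind; by_cases hP : P <;> by_cases hQ : Q <;> simp [hP, hQ]

theorem ind_le_sum {α : Type*} (P : Prop) (s : Finset α) (Q : α → Prop)
    (h : P → ∃ a ∈ s, Q a) : ind P ≤ ∑ a ∈ s, ind (Q a) := by
  by_cases hp : P
  · obtain ⟨a, ha, hq⟩ := h hp
    rw [ind_true hp, ← ind_true hq]
    exact Finset.single_le_sum (f := fun a => ind (Q a)) (fun _ _ => ind_nonneg _) ha
  · rw [ind_false hp]; exact Finset.sum_nonneg fun _ _ => ind_nonneg _

theorem bw_nonneg {p : ℝ} (h0 : 0 ≤ p) (h1 : p ≤ 1) (b : Bool) : 0 ≤ bw p b := by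
  unfold bw; split_ifs <;> linarith

section
variable {ι : Type*} [Fintype ι] {p : ℝ}

theorem wt_nonneg (h0 : 0 ≤ p) (h1 : p ≤ 1) (ω : ι → Bool) : 0 ≤ wt p ω :=
  Finset.prod_nonneg fun _ _ => bw_nonneg h0 h1 _

theorem Ex_mono (h0 : 0 ≤ p) (h1 : p ≤ 1) {f g : (ι → Bool) → ℝ} (h : ∀ ω, f ω ≤ g ω) :
    Ex p f ≤ Ex p g :=
  Finset.sum_le_sum fun ω _ => mul_le_mul_of_nonneg_left (h ω) (wt_nonneg h0 h1 ω)

theorem sum_wt : ∑ ω : ι → Bool, wt p ω = 1 := by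
  unfold wt
  have := Finset.prod_univ_sum (fun _ : ι => (Finset.univ : Finset Bool)) (fun _ b => bw p b)
  rw [Fintype.piFinset_univ] at this
  rw [← this]
  simp [bw]

theorem Ex_const (c : ℝ) : Ex (ι := ι) p (fun _ => c) = c := by
  unfold Ex
  rw [← Finset.sum_mul, sum_wt, one_mul]

theorem Ex_add (f g : (ι → Bool) → ℝ) : Ex p (fun ω => f ω + g ω) = Ex p f + Ex p g := by
  unfold Ex
  rw [← Finset.sum_add_distrib]
  exact Finset.sum_congr rfl fun _ _ => by ring

theorem Ex_mul_left (c : ℝ) (f : (ι → Bool) → ℝ) : Ex p (fun ω => c * f ω) = c * Ex p f := by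
  unfold Ex
  rw [Finset.mul_sum]
  exact Finset.sum_congr rfl fun _ _ => by ring

theorem Ex_sum {α : Type*} (s : Finset α) (f : α → (ι → Bool) → ℝ) :
    Ex p (fun ω => ∑ a ∈ s, f a ω) = ∑ a ∈ s, Ex p (f a) := by
  unfold Ex
  rw [Finset.sum_comm]
  exact Finset.sum_congr rfl fun _ _ => by rw [Finset.mul_sum]

theorem Ex_le_const (h0 : 0 ≤ p) (h1 : p ≤ 1) {f : (ι → Bool) → ℝ} {c : ℝ} (h : ∀ ω, f ω ≤ c) :
    Ex p f ≤ c := (Ex_mono h0 h1 h).trans (Ex_const c).le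

theorem Ex_nonneg (h0 : 0 ≤ p) (h1 : p ≤ 1) {f : (ι → Bool) → ℝ} (h : ∀ ω, 0 ≤ f ω) :
    0 ≤ Ex p f := Finset.sum_nonneg fun ω _ => mul_nonneg (wt_nonneg h0 h1 ω) (h ω)

theorem Prb_nonneg (h0 : 0 ≤ p) (h1 : p ≤ 1) (E : (ι → Bool) → Prop) : 0 ≤ Prb p E :=
  Ex_nonneg h0 h1 fun _ => ind_nonneg _

theorem Prb_le_one (h0 : 0 ≤ p) (h1 : p ≤ 1) (E : (ι → Bool) → Prop) : Prb p E ≤ 1 :=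
  Ex_le_const h0 h1 fun _ => ind_le_one _

theorem Prb_mono (h0 : 0 ≤ p) (h1 : p ≤ 1) {E F : (ι → Bool) → Prop} (h : ∀ ω, E ω → F ω) :
    Prb p E ≤ Prb p F := Ex_mono h0 h1 fun ω => ind_mono (h ω)

theorem Prb_le_sum (h0 : 0 ≤ p) (h1 : p ≤ 1) {α : Type*} (s : Finset α)
    {E : (ι → Bool) → Prop} (F : α → (ι → Bool) → Prop) (h : ∀ ω, E ω → ∃ a ∈ s, F a ω) :
    Prb p E ≤ ∑ a ∈ s, Prb p (F a) := by
  unfold Prb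
  rw [← Ex_sum]
  exact Ex_mono h0 h1 fun ω => ind_le_sum _ _ _ (h ω)

theorem Ex_single (e : ι) (c : Bool) (f : (ι → Bool) → ℝ)
    (hf : ∀ ω ω' : ι → Bool, (∀ i, i ≠ e → ω i = ω' i) → f ω = f ω') :
    Ex p (fun ω => ind (ω e = c) * f ω) = bw p c * Ex p f := by
  set f' : ({j // j ≠ e} → Bool) → ℝ := fun ρ => f ((Equiv.funSplitAt e Bool).symm (true, ρ)) with hf'
  have hff : ∀ b ρ, f ((Equiv.funSplitAt e Bool).symm (b, ρ)) = f' ρ := by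
    intro b ρ
    apply hf
    intro i hi
    simp [Equiv.funSplitAt, Equiv.piSplitAt, hi]
  have hval : ∀ b ρ, ((Equiv.funSplitAt e Bool).symm (b, ρ)) e = b := by
    intro b ρ; simp [Equiv.funSplitAt, Equiv.piSplitAt]
  have hwt : ∀ b ρ, wt p ((Equiv.funSplitAt e Bool).symm (b, ρ)) = bw p b * ∏ j, bw p (ρ j) := by
    intro b ρ
    unfold wt
    rw [← Finset.mul_prod_erase Finset.univ _ (Finset.mem_univ e), hval]
    congr 1
    rw [Finset.prod_subtype (p := fun j => j ≠ e) (Finset.univ.erase e) (by simp)]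
    refine Finset.prod_congr rfl fun j _ => ?_
    simp [Equiv.funSplitAt, Equiv.piSplitAt, j.2]
  unfold Ex
  rw [← (Equiv.funSplitAt e Bool).symm.sum_comp, ← (Equiv.funSplitAt e Bool).symm.sum_comp (fun ω => wt p ω * f ω),
    Fintype.sum_prod_type, Fintype.sum_prod_type]
  simp only [hff, hval, hwt]
  rw [Fintype.sum_bool, Fintype.sum_bool, ← Finset.sum_add_distrib, ← Finset.sum_add_distrib, Finset.mul_sum]
  refine Finset.sum_congr rfl fun ρ _ => ?_
  cases c <;> simp [ind, bw] <;> ring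

theorem Ex_cyl (D : Finset ι) (c : ι → Bool) (f : (ι → Bool) → ℝ)
    (hf : ∀ ω ω' : ι → Bool, (∀ i, i ∉ D → ω i = ω' i) → f ω = f ω') :
    Ex p (fun ω => ind (∀ e ∈ D, ω e = c e) * f ω) = (∏ e ∈ D, bw p (c e)) * Ex p f := by
  induction D using Finset.induction_on with
  | empty => simp [ind]
  | insert a D ha ih =>
    have h1 : (fun ω : ι → Bool => ind (∀ e ∈ insert a D, ω e = c e) * f ω) =
        fun ω => ind (ω a = c a) * (ind (∀ e ∈ D, ω e = c e) * f ω) := by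
      funext ω
      rw [← mul_assoc, ← ind_and]
      congr 2
      simp
    rw [h1, Ex_single, ih, Finset.prod_insert ha]
    · ring
    · intro ω ω' h
      exact hf ω ω' fun i hi => h i (by simp at hi; exact hi.2)
    · intro ω ω' h
      have e1 : f ω = f ω' := hf ω ω' fun i hi => h i (by simp at hi; exact hi.1)
      have e2 : (∀ e ∈ D, ω e = c e) ↔ (∀ e ∈ D, ω' e = c e) := by
        constructor
        · intro H e he; rw [← h e (by rintro rfl; exact ha he)]; exact H e he
        · intro H e he; rw [h e (by rintro rfl; exact ha he)]; exact H e he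
      rw [e1]
      congr 2
      exact propext e2

theorem Ex_sprinkle (p p1 p2 : ℝ) (hp : 1 - p = (1 - p1) * (1 - p2)) (f : (ι → Bool) → ℝ) :
    Ex p f = Ex p1 (fun ω1 => Ex p2 (fun ω2 => f (fun e => ω1 e || ω2 e))) := by
  have hw : ∀ ω : ι → Bool, wt p ω =
      ∑ ω1 : ι → Bool, ∑ ω2 : ι → Bool, wt p1 ω1 * wt p2 ω2 * ind ((fun e => ω1 e || ω2 e) = ω) := by
    intro ω
    have h1 : ∀ e, bw p (ω e) = ∑ a : Bool, ∑ b : Bool, bw p1 a * bw p2 b * ind ((a || b) = ω e) := by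
      intro e
      rcases h : ω e
      · simp [bw, ind]; linarith
      · simp [bw, ind]; linarith
    unfold wt
    simp_rw [h1]
    have h2 := Finset.prod_univ_sum (fun _ : ι => (Finset.univ : Finset Bool))
      (fun e a => ∑ b : Bool, bw p1 a * bw p2 b * ind ((a || b) = ω e))
    rw [Fintype.piFinset_univ] at h2
    rw [h2]
    refine Finset.sum_congr rfl fun ω1 _ => ?_
    have h3 := Finset.prod_univ_sum (fun _ : ι => (Finset.univ : Finset Bool))
      (fun e b => bw p1 (ω1 e) * bw p2 b * ind ((ω1 e || b) = ω e))
    rw [Fintype.piFinset_univ] at h3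
    rw [h3]
    refine Finset.sum_congr rfl fun ω2 _ => ?_
    rw [Finset.prod_mul_distrib, Finset.prod_mul_distrib]
    congr 1
    by_cases h : (fun e => ω1 e || ω2 e) = ω
    · rw [ind_true h]
      exact Finset.prod_eq_one fun e _ => ind_true (congrFun h e)
    · rw [ind_false h]
      have : ∃ e, ¬ (ω1 e || ω2 e) = ω e := by
        by_contra hc; push Not at hc; exact h (funext hc)
      obtain ⟨e, he⟩ := this
      exact Finset.prod_eq_zero (Finset.mem_univ e) (ind_false he)
  unfold Ex
  simp_rw [hw, Finset.sum_mul, Finset.mul_sum]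
  rw [Finset.sum_comm]
  refine Finset.sum_congr rfl fun ω1 _ => ?_
  rw [Finset.sum_comm]
  refine Finset.sum_congr rfl fun ω2 _ => ?_
  rw [Finset.sum_eq_single (fun e => ω1 e || ω2 e)]
  · rw [ind_true rfl]; ring
  · intro b _ hb
    rw [ind_false (fun h => hb h.symm)]; ring
  · simp
end

/-! ### Connectivity bound -/

section
variable {V : Type*} [Fintype V] [DecidableEq V]

def Conn (A U : Finset V) (ω : Sym2 V → Bool) : Prop :=
  ∀ W ⊆ U, W.Nonempty → ∃ w ∈ W, ∃ x ∈ (A ∪ U) \ W, ω s(w, x) = true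

theorem conn_bound {p : ℝ} (h0 : 0 ≤ p) (h1 : p ≤ 1) (N : ℕ) : ∀ (A U : Finset V), Disjoint A U →
    A.card + U.card = N → Prb p (Conn A U) ≤ (1 - (1 - p) ^ N) ^ U.card := by
  have hr : ∀ N : ℕ, 0 ≤ 1 - (1 - p) ^ N := fun N => by
    have : (1 - p) ^ N ≤ 1 := pow_le_one₀ (by linarith) (by linarith)
    linarith
  induction N with
  | zero =>
    intro A U _ hN
    have : U.card = 0 := by omega
    rw [this, pow_zero]
    exact Prb_le_one h0 h1 _
  | succ N ih =>
    intro A U hd hN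
    rcases A.eq_empty_or_nonempty with rfl | ⟨v, hv⟩
    · rcases U.eq_empty_or_nonempty with rfl | hU
      · simp at hN
      · have : Prb p (Conn ∅ U) ≤ 0 := by
          refine Ex_le_const h0 h1 fun ω => ?_
          rw [ind_false]
          intro hc
          obtain ⟨w, hw, x, hx, _⟩ := hc U subset_rfl hU
          simp at hx
        exact this.trans (pow_nonneg (hr _) _)
    · have hvU : v ∉ U := Finset.disjoint_left.1 hd hv
      set A' := A.erase v with hA'
      set D := U.image (fun u => s(v, u)) with hD
      set c : Finset V → Sym2 V → Bool := fun J e => decide (∃ u ∈ J, e = s(v, u)) with hc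
      have hinj : Set.InjOn (fun u => s(v, u)) (U : Set V) := by
        intro a _ b _ hab
        exact Sym2.congr_right.1 hab
      have hcJ : ∀ J u, c J s(v, u) = true ↔ u ∈ J := by
        intro J u
        simp only [hc, decide_eq_true_eq]
        constructor
        · rintro ⟨u', hu', h⟩
          rw [Sym2.congr_right.1 h]; exact hu'
        · intro h; exact ⟨u, h, rfl⟩
      have step1 : Prb p (Conn A U) ≤ ∑ J ∈ U.powerset,
          Ex p (fun ω => ind (∀ e ∈ D, ω e = c J e) * ind (Conn (A' ∪ J) (U \ J) ω)) := by
        rw [← Ex_sum]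
        refine Ex_mono h0 h1 fun ω => ?_
        simp_rw [← ind_and]
        refine ind_le_sum _ _ _ fun hcon => ?_
        refine ⟨U.filter (fun u => ω s(v, u) = true), by simp, ?_, ?_⟩
        · intro e he
          rw [hD, Finset.mem_image] at he
          obtain ⟨u, hu, rfl⟩ := he
          rw [Bool.eq_iff_iff, hcJ]
          simp [hu]
        · intro W hW hne
          obtain ⟨w, hw, x, hx, hwx⟩ := hcon W (hW.trans Finset.sdiff_subset) hne
          refine ⟨w, hw, x, ?_, hwx⟩
          have hw' := hW hw
          simp only [Finset.mem_sdiff, Finset.mem_filter, not_and] at hw'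
          have hxv : x ≠ v := by
            rintro rfl
            exact hw'.2 hw'.1 (by rw [Sym2.eq_swap]; exact hwx)
          simp only [Finset.mem_sdiff, Finset.mem_union, Finset.mem_filter, hA', Finset.mem_erase] at hx ⊢
          refine ⟨?_, hx.2⟩
          rcases hx.1 with h | h
          · exact Or.inl (Or.inl ⟨hxv, h⟩)
          · by_cases h2 : ω s(v, x) = true
            · exact Or.inl (Or.inr ⟨h, h2⟩)
            · exact Or.inr ⟨h, fun h3 => h2 h3.2⟩
      have hAc : A'.card + 1 = A.card := Finset.card_erase_add_one hv
      have step2 : ∀ J ∈ U.powerset,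
          Ex p (fun ω => ind (∀ e ∈ D, ω e = c J e) * ind (Conn (A' ∪ J) (U \ J) ω)) ≤
          p ^ J.card * ((1 - p) * (1 - (1 - p) ^ N)) ^ (U.card - J.card) := by
        intro J hJ
        rw [Finset.mem_powerset] at hJ
        rw [Ex_cyl]
        · have e1 : ∏ e ∈ D, bw p (c J e) = p ^ J.card * (1 - p) ^ (U.card - J.card) := by
            rw [hD, Finset.prod_image hinj]
            have : ∀ u ∈ U, bw p (c J s(v, u)) = if u ∈ J then p else 1 - p := by
              intro u _
              unfold bw
              simp only [hcJ]
            rw [Finset.prod_congr rfl this, Finset.prod_ite, Finset.prod_const, Finset.prod_const]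
            rw [Finset.filter_mem_eq_inter, Finset.inter_eq_right.2 hJ]
            have : U.filter (fun u => u ∉ J) = U \ J := by ext; simp
            rw [this, Finset.card_sdiff_of_subset hJ]
          have e2 : Prb p (Conn (A' ∪ J) (U \ J)) ≤ (1 - (1 - p) ^ N) ^ (U.card - J.card) := by
            have hdJ : Disjoint A' J := (hd.mono_left (Finset.erase_subset _ _)).mono_right hJ
            have := ih (A' ∪ J) (U \ J) ?_ ?_
            · rwa [Finset.card_sdiff_of_subset hJ] at this
            · rw [Finset.disjoint_union_left]
              exact ⟨(hd.mono_left (Finset.erase_subset _ _)).mono_right Finset.sdiff_subset,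
                Finset.disjoint_sdiff⟩
            · rw [Finset.card_union_of_disjoint hdJ, Finset.card_sdiff_of_subset hJ]
              have := Finset.card_le_card hJ
              omega
          rw [e1, mul_pow, ← mul_assoc]
          refine mul_le_mul_of_nonneg_left e2 ?_
          have : 0 ≤ 1 - p := by linarith
          positivity
        · intro ω ω' h
          congr 1
          have hkey : ∀ w ∈ U, ∀ x ∈ (A' ∪ J) ∪ (U \ J), ω s(w, x) = ω' s(w, x) := by
            intro w hw x hx
            apply h
            rw [hD, Finset.mem_image]
            rintro ⟨u, hu, he⟩
            rw [Sym2.eq_iff] at he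
            rcases he with ⟨rfl, _⟩ | ⟨rfl, _⟩
            · exact hvU hw
            · simp only [Finset.mem_union, Finset.mem_sdiff, hA', Finset.mem_erase] at hx
              rcases hx with (hx | hx) | hx
              · exact hx.1 rfl
              · exact hvU (hJ hx)
              · exact hvU hx.1
          apply propext
          unfold Conn
          constructor
          · intro H W hW hne
            obtain ⟨w, hw, x, hx, hwx⟩ := H W hW hne
            exact ⟨w, hw, x, hx, by
              rw [← hkey w (Finset.sdiff_subset (hW hw)) x (Finset.sdiff_subset hx)]; exact hwx⟩
          · intro H W hW hne
            obtain ⟨w, hw, x, hx, hwx⟩ := H W hW hne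
            exact ⟨w, hw, x, hx, by
              rw [hkey w (Finset.sdiff_subset (hW hw)) x (Finset.sdiff_subset hx)]; exact hwx⟩
      refine step1.trans ((Finset.sum_le_sum step2).trans ?_)
      rw [Finset.sum_pow_mul_eq_add_pow]
      apply le_of_eq
      congr 1
      ring

end

def reachSet (n : ℕ) (ω : Sym2 (Fin n) → Bool) (R : Finset (Fin n)) : Finset (Fin n) :=
  Finset.univ.filter (fun v => ∃ r ∈ R, (erGraph n ω).Reachable r v)

theorem erGraph_adj {n : ℕ} {ω : Sym2 (Fin n) → Bool} {a b : Fin n} :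
    (erGraph n ω).Adj a b ↔ ω s(a, b) = true ∧ a ≠ b := by
  simp [erGraph]

theorem subset_reachSet {n : ℕ} (ω : Sym2 (Fin n) → Bool) (R : Finset (Fin n)) :
    R ⊆ reachSet n ω R := by
  intro r hr
  simp only [reachSet, Finset.mem_filter, Finset.mem_univ, true_and]
  exact ⟨r, hr, SimpleGraph.Reachable.refl r⟩

theorem walk_cross {V : Type*} (G : SimpleGraph V) (W : Finset V) (u v : V) (w : G.Walk u v)
    (r : V) (hr : G.Reachable r u) (hu : u ∉ W) (hv : v ∈ W) :
    ∃ x y, G.Reachable r x ∧ x ∉ W ∧ y ∈ W ∧ G.Adj x y := by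
  induction w with
  | nil => exact absurd hv hu
  | @cons a b c hadj w ih =>
    by_cases hb : b ∈ W
    · exact ⟨a, b, hr, hu, hb, hadj⟩
    · exact ih (hr.trans hadj.reachable) hb hv

theorem master {p : ℝ} (h0 : 0 ≤ p) (h1 : p ≤ 1) (n : ℕ) (R S : Finset (Fin n)) (hRS : R ⊆ S) :
    Prb p (fun ω => reachSet n ω R = S) ≤
      (1 - (1 - p) ^ S.card) ^ (S.card - R.card) * ((1 - p) ^ S.card) ^ (n - S.card) := by
  set D := (S ×ˢ Sᶜ).image (fun ab : Fin n × Fin n => s(ab.1, ab.2)) with hD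
  have hinj : Set.InjOn (fun ab : Fin n × Fin n => s(ab.1, ab.2)) (S ×ˢ Sᶜ : Finset _) := by
    rintro ⟨a, b⟩ hab ⟨a', b'⟩ hab' h
    simp only [Finset.coe_product, Set.mem_prod, Finset.mem_coe, Finset.mem_compl] at hab hab'
    simp only [Sym2.eq_iff] at h
    rcases h with ⟨rfl, rfl⟩ | ⟨rfl, rfl⟩
    · rfl
    · exact absurd hab.1 hab'.2
  have hcard : D.card = S.card * (n - S.card) := by
    rw [hD, Finset.card_image_of_injOn hinj, Finset.card_product, Finset.card_compl, Fintype.card_fin]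
  have step1 : Prb p (fun ω => reachSet n ω R = S) ≤
      Ex p (fun ω => ind (∀ e ∈ D, ω e = (fun _ => false) e) * ind (Conn R (S \ R) ω)) := by
    refine Ex_mono h0 h1 fun ω => ?_
    rw [← ind_and]
    refine ind_mono fun hS => ⟨?_, ?_⟩
    · intro e he
      rw [hD, Finset.mem_image] at he
      obtain ⟨⟨a, b⟩, hab, rfl⟩ := he
      simp only [Finset.mem_product, Finset.mem_compl] at hab
      by_contra hne
      have hne' : ω s(a, b) = true := by simpa using hne
      apply hab.2
      have ha := hab.1
      rw [← hS] at ha ⊢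
      simp only [reachSet, Finset.mem_filter, Finset.mem_univ, true_and] at ha ⊢
      obtain ⟨r, hr, hra⟩ := ha
      refine ⟨r, hr, hra.trans (SimpleGraph.Adj.reachable ?_)⟩
      rw [erGraph_adj]
      refine ⟨hne', ?_⟩
      rintro rfl
      exact hab.2 hab.1
    · intro W hW hne
      obtain ⟨w, hw⟩ := hne
      have hwS := hW hw
      rw [Finset.mem_sdiff, ← hS] at hwS
      have hwS1 := hwS.1
      simp only [reachSet, Finset.mem_filter, Finset.mem_univ, true_and] at hwS1
      obtain ⟨r, hr, ⟨wk⟩⟩ := hwS1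
      have hrW : r ∉ W := fun h => (Finset.mem_sdiff.1 (hW h)).2 hr
      obtain ⟨x, y, hx, hxW, hyW, hxy⟩ := walk_cross _ W r w wk r (SimpleGraph.Reachable.refl r) hrW hw
      refine ⟨y, hyW, x, ?_, ?_⟩
      · rw [Finset.mem_sdiff, Finset.union_sdiff_of_subset hRS]
        refine ⟨?_, hxW⟩
        rw [← hS]
        simp only [reachSet, Finset.mem_filter, Finset.mem_univ, true_and]
        exact ⟨r, hr, hx⟩
      · rw [erGraph_adj] at hxy
        rw [Sym2.eq_swap]; exact hxy.1
  refine step1.trans ?_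
  rw [Ex_cyl]
  · have e1 : ∏ e ∈ D, bw p ((fun _ : Sym2 (Fin n) => false) e) = ((1 - p) ^ S.card) ^ (n - S.card) := by
      rw [Finset.prod_const, hcard, pow_mul]; simp [bw]
    rw [e1, mul_comm]
    refine mul_le_mul_of_nonneg_right ?_ (pow_nonneg (pow_nonneg (by linarith) _) _)
    have := conn_bound h0 h1 S.card R (S \ R) Finset.disjoint_sdiff ?_
    · rwa [Finset.card_sdiff_of_subset hRS] at this
    · rw [Finset.card_sdiff_of_subset hRS]
      have := Finset.card_le_card hRS
      omega
  · intro ω ω' h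
    congr 1
    have hkey : ∀ w ∈ S \ R, ∀ x ∈ R ∪ (S \ R), ω s(w, x) = ω' s(w, x) := by
      intro w hw x hx
      rw [Finset.union_sdiff_of_subset hRS] at hx
      apply h
      rw [hD, Finset.mem_image]
      rintro ⟨⟨a, b⟩, hab, he⟩
      simp only [Finset.mem_product, Finset.mem_compl] at hab
      rw [Sym2.eq_iff] at he
      rcases he with ⟨rfl, rfl⟩ | ⟨rfl, rfl⟩
      · exact hab.2 hx
      · exact hab.2 (Finset.mem_sdiff.1 hw).1
    apply propext
    unfold Conn
    constructor
    · intro H W hW hne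
      obtain ⟨w, hw, x, hx, hwx⟩ := H W hW hne
      exact ⟨w, hw, x, hx, by
        rw [← hkey w (hW hw) x (Finset.sdiff_subset hx)]; exact hwx⟩
    · intro H W hW hne
      obtain ⟨w, hw, x, hx, hwx⟩ := H W hW hne
      exact ⟨w, hw, x, hx, by
        rw [hkey w (hW hw) x (Finset.sdiff_subset hx)]; exact hwx⟩

theorem binom_bound (N j : ℕ) (q s : ℝ) (hq0 : 0 ≤ q) (hq1 : q ≤ 1) (hs : |s| ≤ 1) :
    (N.choose j : ℝ) * (q ^ j * (1 - q) ^ (N - j)) ≤ Real.exp (s * (N * q - j) + N * s ^ 2) := by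
  rcases lt_or_ge N j with hj | hj
  · rw [Nat.choose_eq_zero_of_lt hj]; simp; positivity
  have h1 : (N.choose j : ℝ) * ((q * Real.exp s) ^ j * (1 - q) ^ (N - j)) ≤ (q * Real.exp s + (1 - q)) ^ N := by
    rw [add_pow]
    have := Finset.single_le_sum (f := fun m => (q * Real.exp s) ^ m * (1 - q) ^ (N - m) * (N.choose m : ℝ))
      (s := Finset.range (N + 1)) (fun m _ => ?_) (Finset.mem_range.2 (Nat.lt_succ_of_le hj))
    · refine le_trans (le_of_eq ?_) this
      ring
    · have : 0 ≤ 1 - q := by linarith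
      positivity
  have h2 : q * Real.exp s + (1 - q) ≤ Real.exp (q * s + s ^ 2) := by
    have h3 : Real.exp s ≤ 1 + s + s ^ 2 := by
      have := Real.abs_exp_sub_one_sub_id_le hs
      have := (abs_le.1 this).2
      linarith
    have h4 : q * s + s ^ 2 + 1 ≤ Real.exp (q * s + s ^ 2) := Real.add_one_le_exp _
    have h5 : q * Real.exp s ≤ q * (1 + s + s ^ 2) := mul_le_mul_of_nonneg_left h3 hq0
    nlinarith [sq_nonneg s]
  have h3 : (q * Real.exp s + (1 - q)) ^ N ≤ Real.exp (N * (q * s + s ^ 2)) := by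
    rw [Real.exp_nat_mul]
    refine pow_le_pow_left₀ ?_ h2 _
    have : 0 ≤ 1 - q := by linarith
    positivity
  have h4 : (N.choose j : ℝ) * (q ^ j * (1 - q) ^ (N - j)) =
      ((N.choose j : ℝ) * ((q * Real.exp s) ^ j * (1 - q) ^ (N - j))) * Real.exp (-(j * s)) := by
    rw [mul_pow, ← Real.exp_nat_mul, Real.exp_neg]
    field_simp
  rw [h4]
  calc _ ≤ Real.exp (N * (q * s + s ^ 2)) * Real.exp (-(j * s)) :=
        mul_le_mul_of_nonneg_right (h1.trans h3) (Real.exp_pos _).le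
    _ = _ := by rw [← Real.exp_add]; congr 1; ring

theorem size_bound {p : ℝ} (h0 : 0 ≤ p) (h1 : p ≤ 1) (n k : ℕ) (R : Finset (Fin n)) (s : ℝ)
    (hs : |s| ≤ 1) (q : ℝ) (hq : q = 1 - (1 - p) ^ k) :
    Prb p (fun ω => (reachSet n ω R).card = k) ≤
      Real.exp (s * (((n : ℝ) - R.card) * q - (k - R.card)) + n * s ^ 2) := by
  have hRn : R.card ≤ n := by simpa using Finset.card_le_univ R
  rcases lt_or_ge k R.card with hk | hk
  · have : Prb p (fun ω => (reachSet n ω R).card = k) ≤ 0 := by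
      refine Ex_le_const h0 h1 fun ω => ?_
      rw [ind_false]
      intro h
      have := Finset.card_le_card (subset_reachSet ω R)
      omega
    exact this.trans (Real.exp_pos _).le
  have hpk : (1 - p) ^ k ≤ 1 := pow_le_one₀ (by linarith) (by linarith)
  have hpk0 : 0 ≤ (1 - p) ^ k := pow_nonneg (by linarith) _
  have step1 : Prb p (fun ω => (reachSet n ω R).card = k) ≤
      ∑ T ∈ Finset.powersetCard (k - R.card) Rᶜ, Prb p (fun ω => reachSet n ω R = R ∪ T) := by
    refine Prb_le_sum h0 h1 _ _ fun ω hω => ?_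
    refine ⟨reachSet n ω R \ R, ?_, ?_⟩
    · rw [Finset.mem_powersetCard]
      refine ⟨?_, ?_⟩
      · intro x hx; simp only [Finset.mem_sdiff, Finset.mem_compl] at hx ⊢; exact hx.2
      · rw [Finset.card_sdiff_of_subset (subset_reachSet ω R), hω]
    · rw [Finset.union_sdiff_of_subset (subset_reachSet ω R)]
  have step2 : ∀ T ∈ Finset.powersetCard (k - R.card) Rᶜ, Prb p (fun ω => reachSet n ω R = R ∪ T) ≤
      q ^ (k - R.card) * (1 - q) ^ ((n - R.card) - (k - R.card)) := by
    intro T hT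
    rw [Finset.mem_powersetCard] at hT
    have hd : Disjoint R T := (Finset.subset_compl_iff_disjoint_left).1 hT.1
    have hc : (R ∪ T).card = k := by rw [Finset.card_union_of_disjoint hd, hT.2]; omega
    have := master h0 h1 n R (R ∪ T) Finset.subset_union_left
    rw [hc] at this
    refine this.trans (le_of_eq ?_)
    rw [hq]
    congr 2
    · ring
    · omega
  refine step1.trans ((Finset.sum_le_sum step2).trans ?_)
  rw [Finset.sum_const, Finset.card_powersetCard, Finset.card_compl, Fintype.card_fin, nsmul_eq_mul]
  refine (binom_bound (n - R.card) (k - R.card) q s (by linarith) (by linarith) hs).trans ?_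
  apply Real.exp_le_exp.2
  rw [Nat.cast_sub hRn, Nat.cast_sub hk]
  have : (0:ℝ) ≤ R.card * s ^ 2 := by positivity
  nlinarith

/-! ### Parameters, existence and uniqueness of the giant -/

def Ff (lam κ : ℝ) : ℝ := 1 - Real.exp (-(lam * κ)) - κ

theorem Ff_cont (lam : ℝ) : Continuous (Ff lam) := by
  unfold Ff; fun_prop

theorem params (lam : ℝ) (hlam : 1 < lam) : ∃ β ξ1 ξ2 c lam1 : ℝ, 0 < β ∧ β < ξ1 ∧
    ξ2 ≤ 2 * (ξ1 - β) ∧ 0 < c ∧ c ≤ 1 ∧ 0 < lam1 ∧ lam1 < lam ∧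
    (∀ κ, β ≤ κ → κ ≤ ξ1 → c ≤ Ff lam1 κ) ∧ (∀ κ, ξ2 ≤ κ → κ ≤ 1 → Ff lam κ ≤ -c) := by
  have hF0 : Ff lam 0 = 0 := by simp [Ff]
  have hconc : StrictConcaveOn ℝ Set.univ (Ff lam) := by
    refine ⟨convex_univ, ?_⟩
    intro x _ y _ hxy a b ha hb hab
    have hne : -(lam * x) ≠ -(lam * y) := by
      intro h
      have : lam * x = lam * y := by linarith
      exact hxy (mul_left_cancel₀ (by linarith) this)
    have := strictConvexOn_exp.2 (Set.mem_univ (-(lam * x))) (Set.mem_univ (-(lam * y))) hne ha hb hab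
    simp only [smul_eq_mul, Ff] at this ⊢
    have e : -(lam * (a * x + b * y)) = a * -(lam * x) + b * -(lam * y) := by ring
    rw [e]
    have e2 : a * (1 - Real.exp (-(lam * x)) - x) + b * (1 - Real.exp (-(lam * y)) - y) =
      1 - (a * Real.exp (-(lam * x)) + b * Real.exp (-(lam * y))) - (a * x + b * y) := by
      linear_combination hab
    rw [e2]; linarith
  -- a point where F is positive
  obtain ⟨κ0, hκ0, hκ1, hFκ⟩ : ∃ κ0, 0 < κ0 ∧ κ0 ≤ 1 ∧ 0 < Ff lam κ0 := by
    refine ⟨(lam - 1) / lam ^ 2 / 2, ?_, ?_, ?_⟩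
    · have : 0 < lam - 1 := by linarith
      positivity
    · rw [div_div, div_le_one (by positivity)]; nlinarith
    · set κ := (lam - 1) / lam ^ 2 / 2 with hκ
      have hl : 0 < lam - 1 := by linarith
      have hκp : 0 < κ := by positivity
      have hk2 : lam ^ 2 * κ = (lam - 1) / 2 := by rw [hκ]; field_simp
      have h1 : |-(lam * κ)| ≤ 1 := by
        rw [abs_neg, abs_of_pos (by positivity)]
        nlinarith
      have h2 := (abs_le.1 (Real.abs_exp_sub_one_sub_id_le h1)).2
      unfold Ff
      nlinarith
  have hF1 : Ff lam 1 < 0 := by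
    unfold Ff; have := Real.exp_pos (-(lam * 1)); linarith
  obtain ⟨ζ, hζ, hFζ⟩ : ∃ ζ ∈ Set.Icc κ0 1, Ff lam ζ = 0 := by
    have := intermediate_value_Icc' hκ1 (Ff_cont lam).continuousOn
    exact this ⟨hF1.le, hFκ.le⟩
  have hζ0 : 0 < ζ := lt_of_lt_of_le hκ0 hζ.1
  have hpos : ∀ κ, 0 < κ → κ < ζ → 0 < Ff lam κ := by
    intro κ h1 h2
    have := hconc.2 (Set.mem_univ 0) (Set.mem_univ ζ) hζ0.ne
      (show 0 < 1 - κ / ζ by rw [sub_pos, div_lt_one hζ0]; exact h2)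
      (show 0 < κ / ζ by positivity) (by ring)
    simp only [smul_eq_mul, hF0, hFζ, mul_zero, add_zero, zero_add] at this
    rwa [div_mul_cancel₀ _ hζ0.ne'] at this
  have hneg : ∀ κ, ζ < κ → Ff lam κ < 0 := by
    intro κ h1
    have hκ : 0 < κ := hζ0.trans h1
    have := hconc.2 (Set.mem_univ 0) (Set.mem_univ κ) hκ.ne
      (show 0 < 1 - ζ / κ by rw [sub_pos, div_lt_one hκ]; exact h1)
      (show 0 < ζ / κ by positivity) (by ring)
    simp only [smul_eq_mul, hF0, mul_zero, zero_add] at this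
    rw [div_mul_cancel₀ _ hκ.ne', hFζ] at this
    have h3 : 0 < ζ / κ := by positivity
    by_contra hc
    push Not at hc
    have := mul_nonneg h3.le hc
    linarith
  obtain ⟨c1, hc1, hc1'⟩ : ∃ c1 > 0, ∀ κ ∈ Set.Icc (ζ / 10) (4 * ζ / 5), c1 ≤ Ff lam κ := by
    obtain ⟨x, hx, hmin⟩ := isCompact_Icc.exists_isMinOn (s := Set.Icc (ζ / 10) (4 * ζ / 5))
      ⟨ζ / 10, by constructor <;> linarith⟩ (Ff_cont lam).continuousOn
    exact ⟨Ff lam x, hpos x (by linarith [hx.1]) (by linarith [hx.2]), fun κ hκ => hmin hκ⟩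
  obtain ⟨c2, hc2, hc2'⟩ : ∃ c2 > 0, ∀ κ ∈ Set.Icc (7 * ζ / 5) 1, Ff lam κ ≤ -c2 := by
    rcases le_or_gt (7 * ζ / 5) 1 with h | h
    · obtain ⟨x, hx, hmax⟩ := isCompact_Icc.exists_isMaxOn (s := Set.Icc (7 * ζ / 5) 1)
        ⟨1, by constructor <;> linarith⟩ (Ff_cont lam).continuousOn
      exact ⟨-Ff lam x, by have := hneg x (by linarith [hx.1]); linarith,
        fun κ hκ => by have h9 : Ff lam κ ≤ Ff lam x := hmax hκ; linarith⟩
    · exact ⟨1, one_pos, fun κ hκ => by have := hκ.1; have := hκ.2; linarith⟩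
  set δ := min (c1 / 2) (lam / 2) with hδ
  have hδ0 : 0 < δ := by rw [hδ]; apply lt_min <;> linarith
  have hδ1 : δ ≤ c1 / 2 := min_le_left _ _
  have hδ2 : δ ≤ lam / 2 := min_le_right _ _
  refine ⟨ζ / 10, 4 * ζ / 5, 7 * ζ / 5, min (min (c1 / 2) c2) 1, lam - δ, by linarith, by linarith,
    by linarith, ?_, min_le_right _ _, by linarith, by linarith, ?_, ?_⟩
  · apply lt_min (lt_min (by linarith) hc2) one_pos
  · intro κ h1 h2
    have hκ0 : 0 ≤ κ := by linarith
    have hκ1 : κ ≤ 1 := by linarith [hζ.2]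
    have h3 := hc1' κ ⟨h1, h2⟩
    have h4 : Real.exp (-((lam - δ) * κ)) ≤ Real.exp (-(lam * κ)) + δ := by
      have e1 : Real.exp (-((lam - δ) * κ)) * Real.exp (-(δ * κ)) = Real.exp (-(lam * κ)) := by
        rw [← Real.exp_add]; congr 1; ring
      have e2 : 1 - δ * κ ≤ Real.exp (-(δ * κ)) := by
        have := Real.add_one_le_exp (-(δ * κ)); linarith
      have e3 : Real.exp (-((lam - δ) * κ)) ≤ 1 := by
        apply Real.exp_le_one_iff.2
        have : 0 ≤ (lam - δ) * κ := mul_nonneg (by linarith) hκ0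
        linarith
      have e4 := Real.exp_pos (-((lam - δ) * κ))
      have e5 : δ * κ ≤ δ := by nlinarith
      have e6 : 0 ≤ δ * κ := by positivity
      nlinarith
    have h5 : min (min (c1 / 2) c2) 1 ≤ c1 / 2 := (min_le_left _ _).trans (min_le_left _ _)
    unfold Ff at h3 ⊢
    linarith
  · intro κ h1 h2
    have := hc2' κ ⟨h1, h2⟩
    have h5 : min (min (c1 / 2) c2) 1 ≤ c2 := (min_le_left _ _).trans (min_le_right _ _)
    linarith

theorem reachSet_insert_card {n : ℕ} (ω : Sym2 (Fin n) → Bool) (R : Finset (Fin n)) (x : Fin n) :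
    (reachSet n ω (insert x R)).card ≤ (reachSet n ω R).card + (reachSet n ω {x}).card := by
  refine (Finset.card_le_card ?_).trans (Finset.card_union_le _ _)
  intro v hv
  simp only [reachSet, Finset.mem_filter, Finset.mem_univ, true_and, Finset.mem_union,
    Finset.mem_insert, Finset.mem_singleton] at hv ⊢
  obtain ⟨r, hr | hr, h⟩ := hv
  · exact Or.inr ⟨r, hr, h⟩
  · exact Or.inl ⟨r, hr, h⟩

theorem exist_bound (lam1 β ξ1 c : ℝ) (hl : 0 < lam1) (hβ : 0 < β) (hc : 0 < c)
    (hc1 : c ≤ 1) (hF : ∀ κ, β ≤ κ → κ ≤ ξ1 → c ≤ Ff lam1 κ) (n : ℕ) (hn : 0 < n)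
    (hn1 : lam1 ≤ n) (hβ1 : β ≤ 1) :
    Prb (lam1 / n) (fun ω : Sym2 (Fin n) → Bool =>
      ¬ ∃ x, (ξ1 - β) * n ≤ (reachSet n ω {x}).card) ≤
      (n + 1) ^ 2 * Real.exp (-(c ^ 2 / 4 * n)) := by
  have hnr : (0 : ℝ) < n := by exact_mod_cast hn
  have h0 : 0 ≤ lam1 / n := by positivity
  have h1 : lam1 / n ≤ 1 := by rw [div_le_one hnr]; exact hn1
  set Rm : ℕ → Finset (Fin n) := fun m => Finset.univ.filter (fun i => i.val < m) with hRm
  set I := (Finset.range (n + 1) ×ˢ Finset.range (n + 1)).filter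
    (fun mk => β * n ≤ mk.2 ∧ (mk.2 : ℝ) ≤ ξ1 * n) with hI
  have step1 : Prb (lam1 / n) (fun ω : Sym2 (Fin n) → Bool =>
      ¬ ∃ x, (ξ1 - β) * n ≤ (reachSet n ω {x}).card) ≤
      ∑ mk ∈ I, Prb (lam1 / n) (fun ω => (reachSet n ω (Rm mk.1)).card = mk.2) := by
    refine Prb_le_sum h0 h1 _ _ fun ω hω => ?_
    have hex : ∃ m, β * n ≤ (reachSet n ω (Rm m)).card := by
      refine ⟨n, ?_⟩
      have : reachSet n ω (Rm n) = Finset.univ := by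
        apply Finset.eq_univ_of_forall
        intro x
        exact subset_reachSet ω _ (by simp [hRm])
      rw [this, Finset.card_univ, Fintype.card_fin]
      nlinarith
    have hmn : Nat.find hex ≤ n := by
      apply Nat.find_min'
      have : reachSet n ω (Rm n) = Finset.univ := by
        apply Finset.eq_univ_of_forall
        intro x
        exact subset_reachSet ω _ (by simp [hRm])
      rw [this, Finset.card_univ, Fintype.card_fin]
      nlinarith
    have hspec := Nat.find_spec hex
    have hmin : ∀ j, j < Nat.find hex → ¬ β * n ≤ (reachSet n ω (Rm j)).card :=
      fun j hj => Nat.find_min hex hj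
    set m := Nat.find hex with hm
    refine ⟨(m, (reachSet n ω (Rm m)).card), ?_, rfl⟩
    simp only [hI, Finset.mem_filter, Finset.mem_product, Finset.mem_range]
    refine ⟨⟨by omega, ?_⟩, hspec, ?_⟩
    · have := Finset.card_le_univ (reachSet n ω (Rm m))
      rw [Fintype.card_fin] at this
      omega
    · by_contra hgt
      push Not at hgt
      apply hω
      rcases Nat.eq_zero_or_pos m with hm0 | hmpos
      · exfalso
        rw [hm0] at hspec
        have : reachSet n ω (Rm 0) = ∅ := by simp [reachSet, hRm]
        rw [this] at hspec
        simp at hspec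
        nlinarith
      · obtain ⟨j, hj⟩ : ∃ j, m = j + 1 := ⟨m - 1, by omega⟩
        have hjn : j < n := by omega
        refine ⟨⟨j, hjn⟩, ?_⟩
        have hins : Rm m = insert ⟨j, hjn⟩ (Rm j) := by
          ext i
          simp only [hRm, Finset.mem_filter, Finset.mem_univ, true_and, Finset.mem_insert, Fin.ext_iff]
          omega
        have h3 := reachSet_insert_card ω (Rm j) ⟨j, hjn⟩
        rw [← hins] at h3
        have h3' : ((reachSet n ω (Rm m)).card : ℝ) ≤ (reachSet n ω (Rm j)).card +
          (reachSet n ω {⟨j, hjn⟩}).card := by exact_mod_cast h3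
        have h4 := hmin j (by omega)
        push Not at h4
        linarith
  have step2 : ∀ mk ∈ I, Prb (lam1 / n) (fun ω => (reachSet n ω (Rm mk.1)).card = mk.2) ≤
      Real.exp (-(c ^ 2 / 4 * n)) := by
    rintro ⟨m, k⟩ hmk
    simp only [hI, Finset.mem_filter, Finset.mem_product, Finset.mem_range] at hmk
    obtain ⟨_, hk1, hk2⟩ := hmk
    refine (size_bound h0 h1 n k (Rm m) (-(c / 2)) ?_ _ rfl).trans ?_
    · rw [abs_neg, abs_of_pos (by linarith)]; linarith
    apply Real.exp_le_exp.2
    set r : ℝ := ((Rm m).card : ℝ)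
    have hr : 0 ≤ r := Nat.cast_nonneg _
    have hpk : (1 - lam1 / n) ^ k ≤ Real.exp (-(lam1 * (k / n))) := by
      have e : -(lam1 * ((k : ℝ) / n)) = k * (-(lam1 / n)) := by ring
      rw [e, Real.exp_nat_mul]
      apply pow_le_pow_left₀ (by linarith)
      have := Real.add_one_le_exp (-(lam1 / n))
      linarith
    have hpk0 : 0 ≤ (1 - lam1 / n) ^ k := pow_nonneg (by linarith) _
    have hFk := hF (k / n) (by rw [le_div_iff₀ hnr]; exact hk1) (by rw [div_le_iff₀ hnr]; exact hk2)
    unfold Ff at hFk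
    set q := 1 - (1 - lam1 / n) ^ k with hq
    have hq2 : c + k / n ≤ q := by linarith
    have hq3 : c * n + k ≤ n * q := by
      have := mul_le_mul_of_nonneg_left hq2 hnr.le
      have e : (n : ℝ) * (c + k / n) = c * n + k := by field_simp
      linarith
    have hA : c * n ≤ (n - r) * q - (k - r) := by
      have : 0 ≤ r * (1 - q) := mul_nonneg hr (by linarith)
      nlinarith
    nlinarith
  refine step1.trans ((Finset.sum_le_card_nsmul _ _ _ step2).trans ?_)
  rw [nsmul_eq_mul]
  refine mul_le_mul_of_nonneg_right ?_ (Real.exp_pos _).le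
  have : I.card ≤ (n + 1) * (n + 1) := by
    rw [hI]
    refine (Finset.card_filter_le _ _).trans ?_
    simp
  calc (I.card : ℝ) ≤ ((n + 1) * (n + 1) : ℕ) := by exact_mod_cast this
    _ = _ := by push_cast; ring

theorem pow_lower (lam : ℝ) (hl : 0 < lam) (n k : ℕ) (hn : 0 < n) (hn2 : 2 * lam ≤ n) (hk : k ≤ n) :
    Real.exp (-(lam * (k / n))) - 2 * lam ^ 2 / n ≤ (1 - lam / n) ^ k := by
  have hnr : (0 : ℝ) < n := by exact_mod_cast hn
  set p := lam / n with hp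
  have hp0 : 0 < p := by positivity
  have hp2 : p ≤ 1 / 2 := by rw [hp, div_le_iff₀ hnr]; linarith
  have h1 : Real.exp (-p - 2 * p ^ 2) ≤ 1 - p := by
    have h := Real.add_one_le_exp (p + 2 * p ^ 2)
    have e : Real.exp (-p - 2 * p ^ 2) = (Real.exp (p + 2 * p ^ 2))⁻¹ := by
      rw [← Real.exp_neg]; congr 1; ring
    rw [e]
    apply inv_le_of_inv_le₀ (by linarith)
    refine le_trans ?_ h
    rw [inv_le_iff_one_le_mul₀ (by linarith)]
    nlinarith [sq_nonneg p]
  have h2 : Real.exp (k * (-p - 2 * p ^ 2)) ≤ (1 - p) ^ k := by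
    rw [Real.exp_nat_mul]
    exact pow_le_pow_left₀ (Real.exp_pos _).le h1 _
  refine le_trans ?_ h2
  have e1 : Real.exp (k * (-p - 2 * p ^ 2)) = Real.exp (-(lam * (k / n))) * Real.exp (-(2 * k * p ^ 2)) := by
    rw [← Real.exp_add]; congr 1; rw [hp]; ring
  rw [e1]
  have h3 := Real.add_one_le_exp (-(2 * k * p ^ 2))
  have h4 : Real.exp (-(lam * (k / n))) ≤ 1 := by
    apply Real.exp_le_one_iff.2
    have : 0 ≤ lam * ((k : ℝ) / n) := by positivity
    linarith
  have h5 : 2 * k * p ^ 2 ≤ 2 * lam ^ 2 / n := by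
    have hkr : (k : ℝ) ≤ n := by exact_mod_cast hk
    have : 2 * lam ^ 2 / n = 2 * n * p ^ 2 := by rw [hp]; field_simp
    rw [this]
    have : 0 ≤ p ^ 2 := by positivity
    nlinarith
  have h6 := Real.exp_pos (-(lam * (k / n)))
  have h7 : 0 ≤ 2 * k * p ^ 2 := by positivity
  nlinarith

theorem uniq_bound (lam ξ2 b c : ℝ) (hl : 0 < lam) (hc : 0 < c)
    (hc1 : c ≤ 1) (hb : ξ2 ≤ 2 * b) (hF : ∀ κ, ξ2 ≤ κ → κ ≤ 1 → Ff lam κ ≤ -c) (n : ℕ) (hn : 0 < n)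
    (hn2 : 2 * lam ≤ n) (hn3 : (4 * lam ^ 2 + 4) ≤ c * n) :
    Prb (lam / n) (fun ω : Sym2 (Fin n) → Bool =>
      ∃ x y, ¬ (erGraph n ω).Reachable x y ∧ b * n ≤ (reachSet n ω {x}).card ∧
        b * n ≤ (reachSet n ω {y}).card) ≤
      (n + 1) ^ 3 * Real.exp (-(c ^ 2 / 16 * n)) := by
  have hnr : (0 : ℝ) < n := by exact_mod_cast hn
  have h0 : 0 ≤ lam / n := by positivity
  have h1 : lam / n ≤ 1 := by rw [div_le_one hnr]; linarith
  set I := (((Finset.univ : Finset (Fin n)) ×ˢ (Finset.univ : Finset (Fin n))) ×ˢ Finset.range (n + 1)).filter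
    (fun mk => ξ2 * n ≤ mk.2) with hI
  have step1 : Prb (lam / n) (fun ω : Sym2 (Fin n) → Bool =>
      ∃ x y, ¬ (erGraph n ω).Reachable x y ∧ b * n ≤ (reachSet n ω {x}).card ∧
        b * n ≤ (reachSet n ω {y}).card) ≤
      ∑ mk ∈ I, Prb (lam / n) (fun ω => (reachSet n ω {mk.1.1, mk.1.2}).card = mk.2) := by
    refine Prb_le_sum h0 h1 _ _ fun ω hω => ?_
    obtain ⟨x, y, hxy, hx, hy⟩ := hω
    refine ⟨((x, y), (reachSet n ω {x, y}).card), ?_, rfl⟩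
    have hle := Finset.card_le_univ (reachSet n ω {x, y})
    rw [Fintype.card_fin] at hle
    have hd : Disjoint (reachSet n ω {x}) (reachSet n ω {y}) := by
      rw [Finset.disjoint_left]
      intro a ha hb
      simp only [reachSet, Finset.mem_filter, Finset.mem_univ, true_and, Finset.mem_singleton,
        exists_eq_left] at ha hb
      exact hxy (ha.trans hb.symm)
    have hsub : reachSet n ω {x} ∪ reachSet n ω {y} ⊆ reachSet n ω {x, y} := by
      intro a ha
      simp only [reachSet, Finset.mem_union, Finset.mem_filter, Finset.mem_univ, true_and,
        Finset.mem_singleton, Finset.mem_insert, exists_eq_left, exists_eq_or_imp] at ha ⊢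
      exact ha
    have h3 := Finset.card_le_card hsub
    rw [Finset.card_union_of_disjoint hd] at h3
    have h3' : ((reachSet n ω {x}).card : ℝ) + (reachSet n ω {y}).card ≤ (reachSet n ω {x, y}).card := by
      exact_mod_cast h3
    simp only [hI, Finset.mem_filter, Finset.mem_product, Finset.mem_univ, true_and, Finset.mem_range]
    refine ⟨by omega, ?_⟩
    nlinarith
  have step2 : ∀ mk ∈ I, Prb (lam / n) (fun ω => (reachSet n ω {mk.1.1, mk.1.2}).card = mk.2) ≤
      Real.exp (-(c ^ 2 / 16 * n)) := by
    rintro ⟨⟨x, y⟩, k⟩ hmk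
    simp only [hI, Finset.mem_filter, Finset.mem_product, Finset.mem_univ, true_and,
      Finset.mem_range] at hmk
    obtain ⟨hkn, hk⟩ := hmk
    refine (size_bound h0 h1 n k {x, y} (c / 4) ?_ _ rfl).trans ?_
    · rw [abs_of_pos (by linarith)]; linarith
    apply Real.exp_le_exp.2
    have hr2 : ((({x, y} : Finset (Fin n)).card : ℕ) : ℝ) ≤ 2 := by
      exact_mod_cast Finset.card_le_two
    set r : ℝ := ((({x, y} : Finset (Fin n)).card : ℕ) : ℝ)
    have hr : 0 ≤ r := Nat.cast_nonneg _
    have hkn' : k ≤ n := by omega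
    have hpk := pow_lower lam hl n k hn hn2 hkn'
    have hpk0 : 0 ≤ (1 - lam / n) ^ k := pow_nonneg (by linarith) _
    have hpk1 : (1 - lam / n) ^ k ≤ 1 := pow_le_one₀ (by linarith) (by linarith)
    have hknr : (k : ℝ) ≤ n := by exact_mod_cast hkn'
    have hFk := hF (k / n) (by rw [le_div_iff₀ hnr]; exact hk) (by rw [div_le_one hnr]; exact hknr)
    unfold Ff at hFk
    set q := 1 - (1 - lam / n) ^ k with hq
    have hq2 : q ≤ k / n - c + 2 * lam ^ 2 / n := by linarith
    have hq3 : n * q ≤ k - c * n + 2 * lam ^ 2 := by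
      have := mul_le_mul_of_nonneg_left hq2 hnr.le
      have e : (n : ℝ) * (k / n - c + 2 * lam ^ 2 / n) = k - c * n + 2 * lam ^ 2 := by field_simp
      linarith
    have hA : (n - r) * q - (k - r) ≤ -(c * n) / 2 := by
      have : r * (1 - q) ≤ 2 := by
        have : r * (1 - q) ≤ r * 1 := mul_le_mul_of_nonneg_left (by linarith) hr
        linarith
      nlinarith
    have := mul_le_mul_of_nonneg_left hA (show 0 ≤ c / 4 by linarith)
    nlinarith
  refine step1.trans ((Finset.sum_le_card_nsmul _ _ _ step2).trans ?_)
  rw [nsmul_eq_mul]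
  refine mul_le_mul_of_nonneg_right ?_ (Real.exp_pos _).le
  have : I.card ≤ (n * n) * (n + 1) := by
    rw [hI]
    refine (Finset.card_filter_le _ _).trans ?_
    simp
  calc (I.card : ℝ) ≤ ((n * n) * (n + 1) : ℕ) := by exact_mod_cast this
    _ ≤ _ := by push_cast; nlinarith

/-! ### Colours and sprinkling -/

theorem color_bound (n : ℕ) (C : Finset (Fin n)) (a : ZMod 3) :
    ∑ X : Fin n → ZMod 3, (1 / 3 : ℝ) ^ n * ind (8 * (C.filter (fun v => X v = a)).card ≤ C.card) ≤
      Real.exp (-(C.card / 20)) := by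
  set y : ℝ := 9 / 10 with hy
  have hpt : ∀ X : Fin n → ZMod 3, (1 / 3 : ℝ) ^ n * ind (8 * (C.filter (fun v => X v = a)).card ≤ C.card) ≤
      (y ^ C.card)⁻¹ * ∏ v, ((1 / 3) * (if v ∈ C then (if X v = a then y ^ 8 else 1) else 1)) := by
    intro X
    have e1 : ∏ v, ((1 / 3 : ℝ) * (if v ∈ C then (if X v = a then y ^ 8 else 1) else 1)) =
        (1 / 3) ^ n * y ^ (8 * (C.filter (fun v => X v = a)).card) := by
      rw [Finset.prod_mul_distrib, Finset.prod_const, Finset.card_univ, Fintype.card_fin]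
      congr 1
      rw [Finset.prod_ite_mem, Finset.univ_inter, ← Finset.prod_filter, Finset.prod_const, pow_mul]
    rw [e1]
    have e2 : ind (8 * (C.filter (fun v => X v = a)).card ≤ C.card) ≤
        (y ^ C.card)⁻¹ * y ^ (8 * (C.filter (fun v => X v = a)).card) := by
      have hyp : 0 < y := by norm_num [hy]
      by_cases h : 8 * (C.filter (fun v => X v = a)).card ≤ C.card
      · rw [ind_true h, inv_mul_eq_div, le_div_iff₀ (by positivity), one_mul]
        exact pow_le_pow_of_le_one hyp.le (by norm_num [hy]) h
      · rw [ind_false h]; positivity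
    have : (0 : ℝ) ≤ (1 / 3) ^ n := by positivity
    calc _ ≤ (1 / 3 : ℝ) ^ n * ((y ^ C.card)⁻¹ * y ^ (8 * (C.filter (fun v => X v = a)).card)) :=
          mul_le_mul_of_nonneg_left e2 this
      _ = _ := by ring
  refine (Finset.sum_le_sum fun X _ => hpt X).trans ?_
  rw [← Finset.mul_sum]
  have h2 := Finset.prod_univ_sum (fun _ : Fin n => (Finset.univ : Finset (ZMod 3)))
      (fun v x => ((1 / 3 : ℝ) * (if v ∈ C then (if x = a then y ^ 8 else 1) else 1)))
  rw [Fintype.piFinset_univ] at h2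
  rw [← h2]
  have h3 : ∀ v : Fin n, ∑ x : ZMod 3, ((1 / 3 : ℝ) * (if v ∈ C then (if x = a then y ^ 8 else 1) else 1)) =
      if v ∈ C then (2 + y ^ 8) / 3 else 1 := by
    intro v
    rw [← Finset.mul_sum]
    by_cases hv : v ∈ C
    · simp only [hv, if_true]
      have : ∀ x : ZMod 3, (if x = a then y ^ 8 else 1) = 1 + (if x = a then y ^ 8 - 1 else 0) := by
        intro x; split_ifs <;> ring
      simp_rw [this, Finset.sum_add_distrib, Finset.sum_ite_eq' Finset.univ a, Finset.mem_univ, if_true]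
      simp [ZMod.card]; ring
    · simp only [hv, if_false]
      simp [ZMod.card]
  simp_rw [h3]
  rw [Finset.prod_ite_mem, Finset.univ_inter, Finset.prod_const, ← inv_pow, ← mul_pow]
  have h4 : -((C.card : ℝ) / 20) = C.card * (-(1 / 20)) := by ring
  rw [h4, Real.exp_nat_mul]
  apply pow_le_pow_left₀ (by norm_num [hy])
  have := Real.add_one_le_exp (-(1 / 20 : ℝ))
  refine le_trans ?_ this
  norm_num [hy]

theorem quantile {V : Type*} [DecidableEq V] (C : Finset V) (f : V → ℤ) (hC : C.Nonempty)
    (h : ∀ a : ZMod 3, C.card < 8 * (C.filter (fun v => (f v : ZMod 3) = a)).card) :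
    ∃ S T : Finset V, S ⊆ C ∧ T ⊆ C ∧ (∀ s ∈ S, ∀ t ∈ T, f s + 2 ≤ f t) ∧
      C.card ≤ 16 * S.card ∧ C.card ≤ 16 * T.card := by
  have hpos : 0 < C.card := hC.card_pos
  have hb : ∀ v ∈ C, |f v| ≤ ∑ v ∈ C, |f v| := fun v hv =>
    Finset.single_le_sum (f := fun v => |f v|) (fun _ _ => abs_nonneg _) hv
  obtain ⟨a, ha, hmin⟩ := Int.exists_least_of_bdd
    (P := fun a => C.card ≤ 16 * (C.filter (fun v => f v ≤ a)).card)
    ⟨-∑ v ∈ C, |f v|, by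
      intro z hz
      by_contra hc
      have : C.filter (fun v => f v ≤ z) = ∅ := by
        apply Finset.filter_eq_empty_iff.2
        intro v hv hle
        have := hb v hv
        have := neg_abs_le (f v)
        omega
      rw [this] at hz
      simp at hz
      simp [hz] at hpos⟩
    ⟨∑ v ∈ C, |f v|, by
      have : C.filter (fun v => f v ≤ ∑ v ∈ C, |f v|) = C := by
        apply Finset.filter_true_of_mem
        intro v hv
        exact (le_abs_self _).trans (hb v hv)
      rw [this]; omega⟩
  refine ⟨C.filter (fun v => f v ≤ a), C.filter (fun v => a + 2 ≤ f v), Finset.filter_subset _ _,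
    Finset.filter_subset _ _, ?_, ha, ?_⟩
  · intro s hs t ht
    simp only [Finset.mem_filter] at hs ht
    omega
  · have h1 : ¬ C.card ≤ 16 * (C.filter (fun v => f v ≤ a - 1)).card := by
      intro hc
      have := hmin _ hc
      omega
    have h2 := h ((a : ZMod 3) + 2)
    have hsub : C.filter (fun v => (f v : ZMod 3) = (a : ZMod 3) + 2) ⊆
        C.filter (fun v => f v ≤ a - 1) ∪ C.filter (fun v => a + 2 ≤ f v) := by
      intro v hv
      simp only [Finset.mem_filter, Finset.mem_union] at hv ⊢
      have hd : ((f v - a - 2 : ℤ) : ZMod 3) = 0 := by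
        push_cast; rw [hv.2]; ring
      rw [ZMod.intCast_zmod_eq_zero_iff_dvd] at hd
      by_cases h5 : f v ≤ a - 1
      · exact Or.inl ⟨hv.1, h5⟩
      · refine Or.inr ⟨hv.1, ?_⟩
        obtain ⟨k, hk⟩ := hd
        push_cast at hk
        omega
    have h3 := (Finset.card_le_card hsub).trans (Finset.card_union_le _ _)
    omega

/-- `f` is a lift of `X` on the set `C` with respect to the open edges of `ω`. -/
def LiftOn {n : ℕ} (ω : Sym2 (Fin n) → Bool) (X : Fin n → ZMod 3) (C : Finset (Fin n))
    (f : Fin n → ℤ) : Prop :=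
  (∀ v ∈ C, (f v : ZMod 3) = X v) ∧
    ∀ u ∈ C, ∀ v ∈ C, ω s(u, v) = true → u ≠ v → |f v - f u| ≤ 1

theorem lift_const {n : ℕ} (ω : Sym2 (Fin n) → Bool) (X : Fin n → ZMod 3) (y : Fin n)
    (f g : Fin n → ℤ) (hf : LiftOn ω X (reachSet n ω {y}) f) (hg : LiftOn ω X (reachSet n ω {y}) g)
    (u v : Fin n) (w : (erGraph n ω).Walk u v) (hu : (erGraph n ω).Reachable y u) :
    f v - g v = f u - g u := by
  induction w with
  | nil => rfl
  | @cons a b c hadj w ih =>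
    have hb := hu.trans hadj.reachable
    rw [ih hb]
    have ma : a ∈ reachSet n ω {y} := by simp [reachSet, hu]
    have mb : b ∈ reachSet n ω {y} := by simp [reachSet, hb]
    rw [erGraph_adj] at hadj
    have h1 := abs_le.1 (hf.2 a ma b mb hadj.1 hadj.2)
    have h2 := abs_le.1 (hg.2 a ma b mb hadj.1 hadj.2)
    have hd : ((f b - f a - (g b - g a) : ℤ) : ZMod 3) = 0 := by
      push_cast; rw [hf.1 a ma, hf.1 b mb, hg.1 a ma, hg.1 b mb]; ring
    rw [ZMod.intCast_zmod_eq_zero_iff_dvd] at hd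
    obtain ⟨k, hk⟩ := hd
    push_cast at hk
    omega

theorem sprinkle_bound {p : ℝ} (h0 : 0 ≤ p) (h1 : p ≤ 1) {n : ℕ} (ω1 : Sym2 (Fin n) → Bool)
    (X : Fin n → ZMod 3) (y : Fin n)
    (h : ∀ a : ZMod 3, (reachSet n ω1 {y}).card <
      8 * ((reachSet n ω1 {y}).filter (fun v => X v = a)).card) :
    Prb p (fun ω2 : Sym2 (Fin n) → Bool =>
      ∃ f, LiftOn (fun e => ω1 e || ω2 e) X (reachSet n ω1 {y}) f) ≤
      Real.exp (-(p * ((reachSet n ω1 {y}).card : ℝ) ^ 2 / 256)) := by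
  set C := reachSet n ω1 {y} with hC
  have hmono : ∀ (ω2 : Sym2 (Fin n) → Bool) f, LiftOn (fun e => ω1 e || ω2 e) X C f → LiftOn ω1 X C f := by
    intro ω2 f hf
    refine ⟨hf.1, fun u hu v hv he hne => hf.2 u hu v hv ?_ hne⟩
    simp [he]
  by_cases hex : ∃ f0, LiftOn ω1 X C f0
  swap
  · refine le_trans (Ex_le_const (c := 0) h0 h1 fun ω => ?_) (Real.exp_pos _).le
    rw [ind_false]
    rintro ⟨f, hf⟩
    exact hex ⟨f, hmono ω f hf⟩
  obtain ⟨f0, hf0⟩ := hex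
  have hyC : y ∈ C := subset_reachSet ω1 {y} (by simp)
  obtain ⟨S, T, hS, hT, hST, hcS, hcT⟩ := quantile C f0 ⟨y, hyC⟩ (by
    intro a
    have : C.filter (fun v => (f0 v : ZMod 3) = a) = C.filter (fun v => X v = a) := by
      apply Finset.filter_congr
      intro v hv
      rw [hf0.1 v hv]
    rw [this]; exact h a)
  set D := (S ×ˢ T).image (fun ab : Fin n × Fin n => s(ab.1, ab.2)) with hD
  have hinj : Set.InjOn (fun ab : Fin n × Fin n => s(ab.1, ab.2)) (S ×ˢ T : Finset _) := by
    rintro ⟨a, b⟩ hab ⟨a', b'⟩ hab' he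
    simp only [Finset.coe_product, Set.mem_prod, Finset.mem_coe] at hab hab'
    simp only [Sym2.eq_iff] at he
    rcases he with ⟨rfl, rfl⟩ | ⟨rfl, rfl⟩
    · rfl
    · have := hST a hab.1 a hab'.2
      omega
  have hcard : D.card = S.card * T.card := by
    rw [hD, Finset.card_image_of_injOn hinj, Finset.card_product]
  have step1 : Prb p (fun ω2 : Sym2 (Fin n) → Bool =>
      ∃ f, LiftOn (fun e => ω1 e || ω2 e) X C f) ≤
      Ex p (fun ω => ind (∀ e ∈ D, ω e = (fun _ => false) e) * (fun _ => 1) ω) := by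
    refine Ex_mono h0 h1 fun ω => ?_
    simp only [mul_one]
    refine ind_mono ?_
    rintro ⟨f, hf⟩ e he
    rw [hD, Finset.mem_image] at he
    obtain ⟨⟨a, b⟩, hab, rfl⟩ := he
    simp only [Finset.mem_product] at hab
    by_contra hne
    have hne' : ω s(a, b) = true := by simpa using hne
    have hab2 := hST a hab.1 b hab.2
    have hf1 := hmono ω f hf
    have hca : f a - f0 a = f y - f0 y := by
      have ma := hS hab.1
      simp only [hC, reachSet, Finset.mem_filter, Finset.mem_univ, true_and, Finset.mem_singleton,
        exists_eq_left] at ma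
      obtain ⟨w⟩ := ma
      exact lift_const ω1 X y f f0 hf1 hf0 y a w (SimpleGraph.Reachable.refl y)
    have hcb : f b - f0 b = f y - f0 y := by
      have ma := hT hab.2
      simp only [hC, reachSet, Finset.mem_filter, Finset.mem_univ, true_and, Finset.mem_singleton,
        exists_eq_left] at ma
      obtain ⟨w⟩ := ma
      exact lift_const ω1 X y f f0 hf1 hf0 y b w (SimpleGraph.Reachable.refl y)
    have hle := abs_le.1 (hf.2 a (hS hab.1) b (hT hab.2) (by simp [hne']) (by rintro rfl; omega))
    omega
  refine step1.trans ?_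
  rw [Ex_cyl D (fun _ => false) (fun _ => 1) (fun _ _ _ => rfl), Ex_const, mul_one, Finset.prod_const, hcard]
  have e0 : bw p false = 1 - p := by simp [bw]
  rw [e0]
  have e1 : (1 - p) ^ (S.card * T.card) ≤ Real.exp (-(p * (S.card * T.card))) := by
    have e : -(p * ((S.card : ℝ) * T.card)) = ((S.card * T.card : ℕ) : ℝ) * (-p) := by push_cast; ring
    rw [e, Real.exp_nat_mul]
    apply pow_le_pow_left₀ (by linarith)
    have := Real.add_one_le_exp (-p)
    linarith
  refine e1.trans (Real.exp_le_exp.2 ?_)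
  have r1 : (C.card : ℝ) ≤ 16 * S.card := by exact_mod_cast hcS
  have r2 : (C.card : ℝ) ≤ 16 * T.card := by exact_mod_cast hcT
  have r3 : (C.card : ℝ) ^ 2 ≤ 256 * (S.card * T.card) := by
    have := mul_le_mul r1 r2 (Nat.cast_nonneg _) (by positivity)
    nlinarith
  have := mul_le_mul_of_nonneg_left r3 h0
  linarith

/-- The bad event after uniqueness of the giant has been imposed. -/
def Bad' {n : ℕ} (b : ℝ) (ω : Sym2 (Fin n) → Bool) (X : Fin n → ZMod 3) : Prop :=
  ∃ x f, LiftOn ω X (reachSet n ω {x}) f ∧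
    ∀ y, b * n ≤ (reachSet n ω {y}).card → (erGraph n ω).Reachable x y

theorem erGraph_mono {n : ℕ} (ω1 ω2 : Sym2 (Fin n) → Bool) :
    erGraph n ω1 ≤ erGraph n (fun e => ω1 e || ω2 e) := by
  intro a b h
  rw [erGraph_adj] at h ⊢
  exact ⟨by simp [h.1], h.2⟩

theorem sum_third (n : ℕ) : ∑ _X : Fin n → ZMod 3, (1 / 3 : ℝ) ^ n = 1 := by
  rw [Finset.sum_const, Finset.card_univ, Fintype.card_fun, ZMod.card, Fintype.card_fin, nsmul_eq_mul]
  push_cast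
  rw [← mul_pow]; norm_num

theorem bad'_bound (p p1 p2 b : ℝ) (hp : 1 - p = (1 - p1) * (1 - p2))
    (h01 : 0 ≤ p1) (h11 : p1 ≤ 1) (h02 : 0 ≤ p2) (h12 : p2 ≤ 1) (hb : 0 ≤ b) (n : ℕ) :
    Ex p (fun ω : Sym2 (Fin n) → Bool => ∑ X : Fin n → ZMod 3, (1 / 3 : ℝ) ^ n * ind (Bad' b ω X)) ≤
      Prb p1 (fun ω : Sym2 (Fin n) → Bool => ¬ ∃ x, b * n ≤ (reachSet n ω {x}).card) +
      (3 * Real.exp (-(b * n / 20)) + Real.exp (-(p2 * (b * n) ^ 2 / 256))) := by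
  rw [Ex_sprinkle p p1 p2 hp]
  have hE : 0 ≤ 3 * Real.exp (-(b * n / 20)) + Real.exp (-(p2 * (b * n) ^ 2 / 256)) := by positivity
  rw [← Ex_const (ι := Sym2 (Fin n)) (p := p1)
    (3 * Real.exp (-(b * n / 20)) + Real.exp (-(p2 * (b * n) ^ 2 / 256)))]
  unfold Prb
  rw [← Ex_add]
  refine Ex_mono h01 h11 fun ω1 => ?_
  by_cases hex : ∃ x, b * n ≤ (reachSet n ω1 {x}).card
  swap
  · rw [ind_true hex]
    refine le_trans (Ex_le_const (c := 1) h02 h12 fun ω2 => ?_) (by linarith)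
    refine (Finset.sum_le_sum (g := fun _ => (1 / 3 : ℝ) ^ n) fun X _ => ?_).trans (sum_third n).le
    have := ind_le_one (Bad' b (fun e => ω1 e || ω2 e) X)
    have h3 : (0 : ℝ) ≤ (1 / 3) ^ n := by positivity
    nlinarith
  · rw [ind_false (not_not.2 hex), zero_add]
    obtain ⟨y, hy⟩ := hex
    set C := reachSet n ω1 {y} with hC
    rw [Ex_sum]
    simp_rw [Ex_mul_left]
    have hpt : ∀ X : Fin n → ZMod 3, Ex p2 (fun ω2 => ind (Bad' b (fun e => ω1 e || ω2 e) X)) ≤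
        ∑ a : ZMod 3, ind (8 * (C.filter (fun v => X v = a)).card ≤ C.card) +
          Real.exp (-(p2 * (b * n) ^ 2 / 256)) := by
      intro X
      by_cases hcol : ∃ a : ZMod 3, 8 * (C.filter (fun v => X v = a)).card ≤ C.card
      · obtain ⟨a, ha⟩ := hcol
        have h3 : (1 : ℝ) ≤ ∑ a : ZMod 3, ind (8 * (C.filter (fun v => X v = a)).card ≤ C.card) := by
          rw [← ind_true ha]
          exact Finset.single_le_sum
            (f := fun a : ZMod 3 => ind (8 * (C.filter (fun v => X v = a)).card ≤ C.card))
            (fun _ _ => ind_nonneg _) (Finset.mem_univ a)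
        have h4 := Prb_le_one h02 h12 (fun ω2 => (Bad' b (fun e => ω1 e || ω2 e) X))
        unfold Prb at h4
        have := Real.exp_pos (-(p2 * (b * n) ^ 2 / 256))
        linarith
      · push Not at hcol
        have h3 : (0 : ℝ) ≤ ∑ a : ZMod 3, ind (8 * (C.filter (fun v => X v = a)).card ≤ C.card) :=
          Finset.sum_nonneg fun _ _ => ind_nonneg _
        have h4 := sprinkle_bound h02 h12 ω1 X y hcol
        have h5 : Prb p2 (fun ω2 => (Bad' b (fun e => ω1 e || ω2 e) X)) ≤
          Prb p2 (fun ω2 : Sym2 (Fin n) → Bool =>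
            ∃ f, LiftOn (fun e => ω1 e || ω2 e) X (reachSet n ω1 {y}) f) := by
          refine Prb_mono h02 h12 fun ω2 hbad => ?_
          obtain ⟨x, f, hf, hall⟩ := hbad
          have hsub : C ⊆ reachSet n (fun e => ω1 e || ω2 e) {y} := by
            intro v hv
            simp only [hC, reachSet, Finset.mem_filter, Finset.mem_univ, true_and,
              Finset.mem_singleton, exists_eq_left] at hv ⊢
            exact hv.mono (erGraph_mono ω1 ω2)
          have hxy := hall y (hy.trans (by exact_mod_cast Finset.card_le_card hsub))
          have hsub2 : C ⊆ reachSet n (fun e => ω1 e || ω2 e) {x} := by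
            intro v hv
            have := hsub hv
            simp only [reachSet, Finset.mem_filter, Finset.mem_univ, true_and,
              Finset.mem_singleton, exists_eq_left] at this ⊢
            exact hxy.trans this
          exact ⟨f, fun v hv => hf.1 v (hsub2 hv), fun u hu v hv => hf.2 u (hsub2 hu) v (hsub2 hv)⟩
        have h6 : Real.exp (-(p2 * (C.card : ℝ) ^ 2 / 256)) ≤ Real.exp (-(p2 * (b * n) ^ 2 / 256)) := by
          apply Real.exp_le_exp.2
          have : (b * n) ^ 2 ≤ (C.card : ℝ) ^ 2 := pow_le_pow_left₀ (by positivity) hy 2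
          have := mul_le_mul_of_nonneg_left this h02
          linarith
        unfold Prb at h4 h5
        linarith
    have hsum : ∑ X : Fin n → ZMod 3, (1 / 3 : ℝ) ^ n * Ex p2 (fun ω2 => ind (Bad' b (fun e => ω1 e || ω2 e) X)) ≤
        ∑ X : Fin n → ZMod 3, (1 / 3 : ℝ) ^ n * (∑ a : ZMod 3, ind (8 * (C.filter (fun v => X v = a)).card ≤ C.card) +
          Real.exp (-(p2 * (b * n) ^ 2 / 256))) :=
      Finset.sum_le_sum fun X _ => mul_le_mul_of_nonneg_left (hpt X) (by positivity)
    refine hsum.trans ?_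
    simp_rw [mul_add, Finset.sum_add_distrib, ← Finset.sum_mul]
    rw [sum_third, one_mul]
    have : ∑ X : Fin n → ZMod 3, (1 / 3 : ℝ) ^ n * ∑ a : ZMod 3, ind (8 * (C.filter (fun v => X v = a)).card ≤ C.card)
        ≤ 3 * Real.exp (-(b * n / 20)) := by
      simp_rw [Finset.mul_sum]
      rw [Finset.sum_comm]
      refine (Finset.sum_le_card_nsmul _ _ (Real.exp (-(b * n / 20))) fun a _ => ?_).trans ?_
      · refine (color_bound n C a).trans (Real.exp_le_exp.2 ?_)
        linarith
      · simp [ZMod.card]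
    linarith


/-! ### Final assembly -/

def Bad {n : ℕ} (ω : Sym2 (Fin n) → Bool) (X : Fin n → ZMod 3) : Prop :=
  ¬ ∀ x : Fin n,
      (∀ z : Fin n, Set.ncard {y | (erGraph n ω).Reachable z y} ≤
        Set.ncard {y | (erGraph n ω).Reachable x y}) →
      0 < limsup (fun t : ℕ => (ccaNe (erGraph n ω) X t x : ℝ) / t) atTop

def TwoBig {n : ℕ} (b : ℝ) (ω : Sym2 (Fin n) → Bool) : Prop :=
  ∃ x y, ¬ (erGraph n ω).Reachable x y ∧ b * n ≤ (reachSet n ω {x}).card ∧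
        b * n ≤ (reachSet n ω {y}).card

theorem ncard_reach {n : ℕ} (ω : Sym2 (Fin n) → Bool) (x : Fin n) :
    Set.ncard {y | (erGraph n ω).Reachable x y} = (reachSet n ω {x}).card := by
  rw [← Set.ncard_coe_finset]
  congr 1
  ext y
  simp [reachSet]

theorem mem_reach {n : ℕ} {ω : Sym2 (Fin n) → Bool} {x y : Fin n} :
    y ∈ reachSet n ω {x} ↔ (erGraph n ω).Reachable x y := by
  simp [reachSet]

theorem bad_imp {n : ℕ} (b : ℝ) (ω : Sym2 (Fin n) → Bool) (X : Fin n → ZMod 3)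
    (h : Bad ω X) : TwoBig b ω ∨ Bad' b ω X := by
  unfold Bad at h
  push Not at h
  obtain ⟨x, hmax, hlim⟩ := h
  by_cases h2 : TwoBig b ω
  · exact Or.inl h2
  right
  obtain ⟨f, hf1, hf2⟩ := exists_lift (erGraph n ω) X x (not_lt.2 hlim)
  refine ⟨x, f, ⟨fun v hv => hf1 v (mem_reach.1 hv), fun u hu v _ he hne =>
    hf2 u v (mem_reach.1 hu) (erGraph_adj.2 ⟨he, hne⟩)⟩, fun y hy => ?_⟩
  by_contra hc
  refine h2 ⟨x, y, hc, hy.trans ?_, hy⟩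
  have := hmax y
  rw [ncard_reach, ncard_reach] at this
  exact_mod_cast this

set_option maxHeartbeats 2000000 in
theorem bad_total (lam : ℝ) (hlam : 1 < lam) : ∃ D : ℝ, 0 < D ∧ ∃ N : ℕ, ∀ n : ℕ, N ≤ n →
    lam ≤ n ∧ 0 < n ∧
    Ex (lam / n) (fun ω : Sym2 (Fin n) → Bool => ∑ X : Fin n → ZMod 3, (1 / 3 : ℝ) ^ n * ind (Bad ω X))
      ≤ Real.exp (-D * n) := by
  obtain ⟨β, ξ1, ξ2, c, lam1, hβ, hβξ, hξ2, hc, hc1, hl1, hl1', hF1, hF2⟩ := params lam hlam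
  have hβ1 : β ≤ 1 := by
    have := hF1 β le_rfl hβξ.le
    unfold Ff at this
    have := Real.exp_pos (-(lam1 * β))
    linarith
  set b := ξ1 - β with hb
  have hb0 : 0 < b := by linarith
  obtain ⟨r, hr0, hr1, hr2, hr3, hr4⟩ : ∃ r : ℝ, 0 < r ∧ r ≤ c ^ 2 / 16 ∧ r ≤ c ^ 2 / 4 ∧ r ≤ b / 20 ∧
      r ≤ (lam - lam1) * b ^ 2 / 256 := by
    have h3 : 0 < (lam - lam1) * b ^ 2 / 256 := by
      have : 0 < lam - lam1 := by linarith
      positivity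
    refine ⟨min (c ^ 2 / 16) (min (b / 20) ((lam - lam1) * b ^ 2 / 256)), ?_, min_le_left _ _, ?_, ?_, ?_⟩
    · refine lt_min (by positivity) (lt_min (by positivity) h3)
    · refine (min_le_left _ _).trans ?_
      have := sq_nonneg c
      linarith
    · exact (min_le_right _ _).trans (min_le_left _ _)
    · exact (min_le_right _ _).trans (min_le_right _ _)
  refine ⟨r / 2, by positivity, ?_⟩
  have hev : ∀ᶠ n : ℕ in atTop, 6 * ((n : ℝ) + 1) ^ 3 * Real.exp (-(r / 2 * n)) ≤ 1 := by
    have h1 : Tendsto (fun n : ℕ => (r / 2) * ((n : ℝ) + 1)) atTop atTop :=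
      (tendsto_atTop_add_const_right _ _ tendsto_natCast_atTop_atTop).const_mul_atTop (by positivity)
    have h2 := (Real.tendsto_pow_mul_exp_neg_atTop_nhds_zero 3).comp h1
    have h3 := h2.const_mul (6 * Real.exp (r / 2) / (r / 2) ^ 3)
    rw [mul_zero] at h3
    filter_upwards [h3.eventually_le_const (show (0 : ℝ) < 1 by norm_num)] with n hn
    refine le_trans (le_of_eq ?_) hn
    simp only [Function.comp]
    have : Real.exp (-(r / 2 * n)) = Real.exp (r / 2) * Real.exp (-(r / 2 * (n + 1))) := by
      rw [← Real.exp_add]; ring_nf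
    rw [this]
    field_simp
  have hev2 : ∀ᶠ n : ℕ in atTop, 2 * lam + (4 * lam ^ 2 + 4) / c ≤ (n : ℝ) :=
    tendsto_natCast_atTop_atTop.eventually_ge_atTop _
  obtain ⟨N, hN⟩ := eventually_atTop.1 (hev.and hev2)
  refine ⟨N, fun n hn => ?_⟩
  obtain ⟨hn1, hn2⟩ := hN n hn
  have hq : 0 < (4 * lam ^ 2 + 4) / c := by positivity
  have hnl : 2 * lam ≤ n := by linarith
  have hn3 : (4 * lam ^ 2 + 4) ≤ c * n := by
    have : (4 * lam ^ 2 + 4) / c ≤ n := by linarith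
    rw [div_le_iff₀ hc] at this
    linarith
  have hnr : (0 : ℝ) < n := by linarith
  have hn0 : 0 < n := by exact_mod_cast hnr
  refine ⟨by linarith, hn0, ?_⟩
  have h0 : 0 ≤ lam / n := by positivity
  have h1 : lam / n ≤ 1 := by rw [div_le_one hnr]; linarith
  have h01 : 0 ≤ lam1 / n := by positivity
  have h11 : lam1 / n < 1 := by rw [div_lt_one hnr]; linarith
  have hpp : lam1 / n < lam / n := by gcongr
  have hd : 0 < 1 - lam1 / n := by linarith
  set p2 := (lam / n - lam1 / n) / (1 - lam1 / n) with hp2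
  have h02 : 0 ≤ p2 := div_nonneg (by linarith) hd.le
  have h12 : p2 ≤ 1 := by rw [hp2, div_le_one hd]; linarith
  have hple : (lam - lam1) / n ≤ p2 := by
    rw [hp2, le_div_iff₀ hd, sub_div]
    nlinarith
  have hprod : 1 - lam / n = (1 - lam1 / n) * (1 - p2) := by
    have : (1 - lam1 / n) * p2 = lam / n - lam1 / n := by
      rw [hp2]; exact mul_div_cancel₀ _ hd.ne'
    linarith
  have e1 := exist_bound lam1 β ξ1 c hl1 hβ hc hc1 hF1 n hn0 (by linarith) hβ1
  have e2 := uniq_bound lam ξ2 b c (by linarith) hc hc1 hξ2 hF2 n hn0 hnl hn3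
  have e3 := bad'_bound (lam / n) (lam1 / n) p2 b hprod h01 h11.le h02 h12 hb0.le n
  have e4 : Ex (lam / n) (fun ω : Sym2 (Fin n) → Bool => ∑ X : Fin n → ZMod 3, (1 / 3 : ℝ) ^ n * ind (Bad ω X))
      ≤ Prb (lam / n) (TwoBig (n := n) b) +
       Ex (lam / n) (fun ω : Sym2 (Fin n) → Bool => ∑ X : Fin n → ZMod 3, (1 / 3 : ℝ) ^ n * ind (Bad' b ω X)) := by
    unfold Prb
    rw [← Ex_add]
    refine Ex_mono h0 h1 fun ω => ?_
    have : ind (TwoBig b ω) = ∑ X : Fin n → ZMod 3, (1 / 3 : ℝ) ^ n * ind (TwoBig b ω) := by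
      rw [← Finset.sum_mul, sum_third, one_mul]
    rw [this, ← Finset.sum_add_distrib]
    refine Finset.sum_le_sum fun X _ => ?_
    rw [← mul_add]
    refine mul_le_mul_of_nonneg_left ?_ (by positivity)
    by_cases hbad : Bad ω X
    · rw [ind_true hbad]
      rcases bad_imp b ω X hbad with h | h
      · rw [ind_true h]; have := ind_nonneg (Bad' b ω X); linarith
      · rw [ind_true h]; have := ind_nonneg (TwoBig b ω); linarith
    · rw [ind_false hbad]
      exact add_nonneg (ind_nonneg _) (ind_nonneg _)
  have e2' : Prb (lam / n) (TwoBig (n := n) b) ≤ (n + 1) ^ 3 * Real.exp (-(c ^ 2 / 16 * n)) := e2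
  have hE : ∀ a : ℝ, r * n ≤ a → Real.exp (-a) ≤ Real.exp (-(r * n)) := fun a ha =>
    Real.exp_le_exp.2 (by linarith)
  have f1 := hE (c ^ 2 / 16 * n) (by gcongr)
  have f2 := hE (c ^ 2 / 4 * n) (by gcongr)
  have f3 := hE (b * n / 20) (by nlinarith)
  have f4 := hE (p2 * (b * n) ^ 2 / 256) (by
    have : (lam - lam1) / n * (b * n) ^ 2 ≤ p2 * (b * n) ^ 2 := by gcongr
    have e : (lam - lam1) / n * (b * n) ^ 2 = (lam - lam1) * b ^ 2 * n := by field_simp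
    rw [e] at this
    nlinarith)
  set E := Real.exp (-(r * n)) with hEdef
  have hEpos : 0 < E := Real.exp_pos _
  have hsplit : E = Real.exp (-(r / 2 * n)) * Real.exp (-(r / 2) * n) := by
    rw [hEdef, ← Real.exp_add]; ring_nf
  set M := (n : ℝ) + 1 with hM
  have hM1 : 1 ≤ M := by linarith
  have g1 : M ^ 3 * Real.exp (-(c ^ 2 / 16 * n)) ≤ M ^ 3 * E := by gcongr
  have g2 : M ^ 2 * Real.exp (-(c ^ 2 / 4 * n)) ≤ M ^ 3 * E := by
    have : M ^ 2 ≤ M ^ 3 := pow_le_pow_right₀ hM1 (by norm_num)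
    gcongr
  have g3 : E ≤ M ^ 3 * E := by
    have : 1 ≤ M ^ 3 := one_le_pow₀ hM1
    nlinarith
  have tot : Ex (lam / n) (fun ω : Sym2 (Fin n) → Bool => ∑ X : Fin n → ZMod 3, (1 / 3 : ℝ) ^ n * ind (Bad ω X))
      ≤ 6 * M ^ 3 * E := by linarith
  refine tot.trans ?_
  rw [hsplit, ← mul_assoc]
  have := mul_le_mul_of_nonneg_right hn1 (Real.exp_pos (-(r / 2) * n)).le
  linarith

/-- For `λ > 1`, there is `D > 0` such that for all large `n`, with probability at least
`1 − e^{−Dn}` the 3-color CCA with uniformly random initial coloring oscillates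
(has positive activity) on the largest connected component of `G(n, λ/n)`. -/
theorem cca_oscillates_on_supercritical_er (lam : ℝ) (hlam : 1 < lam) :
    ∃ D : ℝ, 0 < D ∧ ∃ N : ℕ, ∀ n : ℕ, N ≤ n →
      ∀ μ : Measure ((Sym2 (Fin n) → Bool) × (Fin n → ZMod 3)),
        IsProbabilityMeasure μ →
        (∀ (s : Finset (Sym2 (Fin n))) (c : Sym2 (Fin n) → Bool)
            (u : Finset (Fin n)) (d : Fin n → ZMod 3),
          μ {ω | (∀ e ∈ s, ω.1 e = c e) ∧ (∀ v ∈ u, ω.2 v = d v)} =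
            (∏ e ∈ s, (if c e then ENNReal.ofReal (lam / n)
              else ENNReal.ofReal (1 - lam / n))) * (1 / 3 : ENNReal) ^ u.card) →
        1 - ENNReal.ofReal (Real.exp (-D * n)) ≤
          μ {ω | ∀ x : Fin n,
            (∀ z : Fin n, Set.ncard {y | (erGraph n ω.1).Reachable z y} ≤
              Set.ncard {y | (erGraph n ω.1).Reachable x y}) →
            0 < limsup (fun t : ℕ => (ccaNe (erGraph n ω.1) ω.2 t x : ℝ) / t) atTop} := by
  obtain ⟨D, hD, N, hN⟩ := bad_total lam hlam
  refine ⟨D, hD, N, fun n hn μ hμ hcyl => ?_⟩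
  obtain ⟨hln, hn0, htot⟩ := hN n hn
  have hnr : (0 : ℝ) < n := by exact_mod_cast hn0
  have h0 : 0 ≤ lam / n := by positivity
  have h1 : lam / n ≤ 1 := by rw [div_le_one hnr]; exact hln
  have hsing : ∀ (w : Sym2 (Fin n) → Bool) (X : Fin n → ZMod 3),
      μ {(w, X)} = ENNReal.ofReal (wt (lam / n) w * (1 / 3 : ℝ) ^ n) := by
    intro w X
    have h := hcyl Finset.univ w Finset.univ X
    have hs : {ω : (Sym2 (Fin n) → Bool) × (Fin n → ZMod 3) |
        (∀ e ∈ Finset.univ, ω.1 e = w e) ∧ (∀ v ∈ Finset.univ, ω.2 v = X v)} = {(w, X)} := by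
      ext ω
      simp only [Finset.mem_univ, true_imp_iff, Set.mem_ofPred_eq, Set.mem_singleton_iff]
      rw [← funext_iff, ← funext_iff, Prod.ext_iff]
    rw [hs] at h
    rw [h, ENNReal.ofReal_mul (wt_nonneg h0 h1 w), ENNReal.ofReal_pow (by norm_num), Finset.card_univ,
      Fintype.card_fin]
    congr 1
    · unfold wt
      rw [ENNReal.ofReal_prod_of_nonneg fun e _ => bw_nonneg h0 h1 _]
      refine Finset.prod_congr rfl fun e _ => ?_
      unfold bw
      split_ifs <;> rfl
    · congr 1
      rw [ENNReal.ofReal_div_of_pos (by norm_num)]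
      simp
  set good := {ω : (Sym2 (Fin n) → Bool) × (Fin n → ZMod 3) | ∀ x : Fin n,
            (∀ z : Fin n, Set.ncard {y | (erGraph n ω.1).Reachable z y} ≤
              Set.ncard {y | (erGraph n ω.1).Reachable x y}) →
            0 < limsup (fun t : ℕ => (ccaNe (erGraph n ω.1) ω.2 t x : ℝ) / t) atTop} with hgood
  have hcompl : goodᶜ ⊆ ⋃ ω ∈ (Finset.univ : Finset ((Sym2 (Fin n) → Bool) × (Fin n → ZMod 3))).filter
      (fun ω => Bad ω.1 ω.2), ({ω} : Set _) := by
    intro ω hω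
    simp only [Set.mem_iUnion, Finset.mem_filter, Finset.mem_univ, true_and, Set.mem_singleton_iff]
    exact ⟨ω, hω, rfl⟩
  have hbad : μ goodᶜ ≤ ENNReal.ofReal (Real.exp (-D * n)) := by
    refine (measure_mono hcompl).trans ((measure_biUnion_finset_le _ _).trans ?_)
    have hnn : ∀ ω : (Sym2 (Fin n) → Bool) × (Fin n → ZMod 3),
        0 ≤ wt (lam / n) ω.1 * (1 / 3 : ℝ) ^ n := fun ω =>
      mul_nonneg (wt_nonneg h0 h1 _) (by positivity)
    rw [Finset.sum_congr rfl fun ω _ => hsing ω.1 ω.2, ← ENNReal.ofReal_sum_of_nonneg fun ω _ => hnn ω]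
    refine ENNReal.ofReal_le_ofReal (le_trans (le_of_eq ?_) htot)
    rw [Finset.sum_filter, Fintype.sum_prod_type]
    unfold Ex
    refine Finset.sum_congr (by ext; simp) fun w _ => ?_
    rw [Finset.mul_sum]
    refine Finset.sum_congr rfl fun X _ => ?_
    unfold ind
    split_ifs <;> simp
  rw [tsub_le_iff_right]
  calc (1 : ENNReal) = μ Set.univ := measure_univ.symm
    _ = μ (good ∪ goodᶜ) := by rw [Set.union_compl_self]
    _ ≤ μ good + μ goodᶜ := measure_union_le _ _
    _ ≤ _ := by gcongr
end
end

section
/- Let Γ=(V,E) be an infinite, locally finite tree rooted at 0, and let X_0 be a random 3-coloring of V drawn from the product measure with marginals P(X_0(σ)=i)=p_i for i ∈ ℤ/3ℤ (p_0,p_1,p_2 > 0, p_0+p_1+p_2=1). Let v_c be the cloud speed of the Γ-indexed walk S_σ = ∫_{P_σ} dX_0 associated to the 3-color CCA. Then, almost surely, Λ*_CCA(v_c) ≤ h̄(Γ), where h̄(Γ) is the reduced volume entropy of Γ. -/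
noncomputable section
attribute [local instance] Classical.propDecidable

open Filter MeasureTheory

variable {V : Type*}

/-- Unique representative in `{-1,0,1}` of an element of `ℤ/3ℤ`. -/
def ZMod.repInt (a : ZMod 3) : ℤ := if a = 0 then 0 else if a = 1 then 1 else -1

/-- The CCA 1-form `dX` on ordered pairs of vertices. -/
def dXcca (X : V → ZMod 3) (u v : V) : ℤ := (X v - X u).repInt

/-- Path integral of the CCA 1-form along a walk. -/
def walkIntCCA {G : SimpleGraph V} (X : V → ZMod 3) {x y : V} (w : G.Walk x y) : ℤ :=
  (w.darts.map fun d => dXcca X d.toProd.1 d.toProd.2).sum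

/-- The largest positive root `x(t)` of `x³ − x² = q(e^{3t} + e^{−3t} − 2)`
(here `q = p₀p₁p₂`). -/
def cubicRoot (q t : ℝ) : ℝ :=
  sSup {x : ℝ | 0 < x ∧ x ^ 3 - x ^ 2 = q * (Real.exp (3 * t) + Real.exp (-(3 * t)) - 2)}

/-- `Λ_CCA(t) = log x(t)`. -/
def LambdaCCA (q t : ℝ) : ℝ := Real.log (cubicRoot q t)

/-- The Legendre transform `Λ*_CCA(u) = sup_{t ≥ 0} (ut − Λ_CCA(t))`, valued in `EReal`
(it may be `+∞`). -/
def LstarCCA (q u : ℝ) : EReal :=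
  ⨆ t : Set.Ici (0 : ℝ), ((u * t.1 - LambdaCCA q t.1 : ℝ) : EReal)

/-- `τ` is a descendant of `σ` in the tree `G` rooted at `r`. -/
def IsDesc (G : SimpleGraph V) (r σ τ : V) : Prop :=
  G.dist r τ = G.dist r σ + G.dist σ τ

/-- `A_{n,m}`: the number of vertices at level `n` having a descendant at level `m`. -/
def levelSurvivorCount (G : SimpleGraph V) (r : V) (n m : ℕ) : ℕ :=
  Set.ncard {σ : V | G.dist r σ = n ∧ ∃ τ : V, IsDesc G r σ τ ∧ G.dist r τ = m}

/-- The `ρ`-volume entropy `h_ρ(Γ) = limsup_n (1/n) log A_{n,⌊ρn⌋}`, valued in `EReal`. -/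
def rVolumeEntropy (G : SimpleGraph V) (r : V) (ρ : ℝ) : EReal :=
  limsup (fun n : ℕ =>
    ((Real.log (levelSurvivorCount G r n ⌊ρ * n⌋₊) / n : ℝ) : EReal)) atTop

/-- The reduced volume entropy `h̄(Γ) = limsup_{ρ ↘ 1} h_ρ(Γ)`. -/
def reducedVolumeEntropy (G : SimpleGraph V) (r : V) : EReal :=
  limsup (fun ρ : ℝ => rVolumeEntropy G r ρ) (nhdsWithin 1 (Set.Ioi (1 : ℝ)))

/-- The cloud speed of the tree-indexed walk `S` on the tree `G` rooted at `r`. -/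
def cloudSpeed (G : SimpleGraph V) (r : V) (S : V → ℤ) : ℝ :=
  limsup (fun n : ℕ =>
    sSup {x : ℝ | ∃ σ : V, G.dist r σ = n ∧ (S σ : ℝ) = x} / n) atTop

lemma repInt_abs_le (a : ZMod 3) : -1 ≤ a.repInt ∧ a.repInt ≤ 1 := by
  unfold ZMod.repInt
  split_ifs <;> norm_num

lemma walkIntCCA_nil {G : SimpleGraph V} (X : V → ZMod 3) (x : V) :
    walkIntCCA X (SimpleGraph.Walk.nil : G.Walk x x) = 0 := by
  simp [walkIntCCA]

lemma walkIntCCA_cons {G : SimpleGraph V} (X : V → ZMod 3) {x z y : V} (h : G.Adj x z)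
    (w : G.Walk z y) :
    walkIntCCA X (SimpleGraph.Walk.cons h w) = (X z - X x).repInt + walkIntCCA X w := by
  simp [walkIntCCA, dXcca]

lemma walkIntCCA_append {G : SimpleGraph V} (X : V → ZMod 3) {x z y : V} (w : G.Walk x z)
    (w' : G.Walk z y) :
    walkIntCCA X (w.append w') = walkIntCCA X w + walkIntCCA X w' := by
  simp [walkIntCCA, SimpleGraph.Walk.darts_append]

lemma walkIntCCA_bound {G : SimpleGraph V} (X : V → ZMod 3) {x y : V} (w : G.Walk x y) :
    -(w.length : ℤ) ≤ walkIntCCA X w ∧ walkIntCCA X w ≤ w.length := by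
  induction w with
  | nil => simp [walkIntCCA_nil]
  | @cons u v _ h w ih =>
    rw [walkIntCCA_cons, SimpleGraph.Walk.length_cons]
    push_cast
    constructor
    · linarith [(repInt_abs_le (X v - X u : ZMod 3)).1, ih.1]
    · linarith [(repInt_abs_le (X v - X u : ZMod 3)).2, ih.2]

/-- ancestors -/
lemma exists_ancestor (G : SimpleGraph V) (hc : G.Connected) (r τ : V) (n : ℕ)
    (hn : n ≤ G.dist r τ) :
    ∃ σ, G.dist r σ = n ∧ IsDesc G r σ τ ∧
      ∀ (S : V → ℤ) (X : V → ZMod 3), (∀ (σ : V) (q : G.Walk r σ), q.IsPath →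
        S σ = walkIntCCA X q) → S τ ≤ S σ + ((G.dist r τ : ℤ) - n) := by
  obtain ⟨p, hp⟩ := hc.exists_walk_length_eq_dist r τ
  have h1 : (p.take n).length = n := by
    rw [SimpleGraph.Walk.take_length]; omega
  have h2 : (p.drop n).length = G.dist r τ - n := by
    rw [SimpleGraph.Walk.drop_length]; omega
  have h3 := SimpleGraph.dist_le (p.take n)
  have h4 := SimpleGraph.dist_le (p.drop n)
  have h5 := hc.dist_triangle (u := r) (v := p.getVert n) (w := τ)
  refine ⟨p.getVert n, by omega, by unfold IsDesc; omega, ?_⟩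
  intro S X hS
  rw [hS τ p (p.isPath_of_length_eq_dist hp),
    hS _ (p.take n) ((p.take n).isPath_of_length_eq_dist (by omega))]
  conv_lhs => rw [← p.append_take_drop_eq n]
  rw [walkIntCCA_append]
  have := (walkIntCCA_bound X (p.drop n)).2
  rw [h2] at this
  omega

lemma level_finite (G : SimpleGraph V) (hc : G.Connected)
    (hlf : ∀ v : V, (G.neighborSet v).Finite) (r : V) (n : ℕ) :
    {σ : V | G.dist r σ = n}.Finite := by
  induction n with
  | zero =>
    refine (Set.finite_singleton r).subset ?_
    intro σ hσ
    have := (hc.dist_eq_zero_iff (u := r) (v := σ)).1 hσ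
    simp [this]
  | succ n ih =>
    refine (ih.biUnion (t := fun v => G.neighborSet v) (fun v _ => hlf v)).subset ?_
    intro τ hτ
    simp only [Set.mem_ofPred_eq] at hτ
    obtain ⟨σ, h1, h2, -⟩ := exists_ancestor G hc r τ n (by omega)
    simp only [Set.mem_iUnion, Set.mem_ofPred_eq]
    refine ⟨σ, h1, ?_⟩
    have : G.dist σ τ = 1 := by unfold IsDesc at h2; omega
    exact SimpleGraph.dist_eq_one_iff_adj.1 this

lemma entropy_nonneg (G : SimpleGraph V) (r : V) :
    0 ≤ reducedVolumeEntropy G r := by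
  unfold reducedVolumeEntropy
  have h : ∀ ρ : ℝ, 0 ≤ rVolumeEntropy G r ρ := by
    intro ρ
    unfold rVolumeEntropy
    refine le_limsup_of_frequently_le (Frequently.of_forall ?_) (by isBoundedDefault)
    intro n
    have : (0:ℝ) ≤ Real.log (levelSurvivorCount G r n ⌊ρ * n⌋₊) / n :=
      div_nonneg (Real.log_natCast_nonneg _) (by positivity)
    exact_mod_cast this
  exact le_limsup_of_frequently_le (Frequently.of_forall h) (by isBoundedDefault)

/-- the cubic root -/
lemma cubicRoot_spec (q t : ℝ) (hq : 0 < q) :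
    1 ≤ cubicRoot q t ∧ cubicRoot q t ^ 3 - cubicRoot q t ^ 2 =
      q * (Real.exp (3 * t) + Real.exp (-(3 * t)) - 2) := by
  set c := q * (Real.exp (3 * t) + Real.exp (-(3 * t)) - 2) with hcdef
  have hc : 0 ≤ c := by
    apply mul_nonneg hq.le
    have h1 : Real.exp (3 * t) * Real.exp (-(3 * t)) = 1 := by
      rw [← Real.exp_add]; simp
    nlinarith [Real.exp_pos (3 * t), Real.exp_pos (-(3 * t)),
      sq_nonneg (Real.exp (3 * t) - Real.exp (-(3 * t)))]
  have hiv : ∃ x ∈ Set.Icc (1:ℝ) (1 + c), x ^ 3 - x ^ 2 = c := by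
    have := intermediate_value_Icc (a := (1:ℝ)) (b := 1 + c) (by linarith)
      (f := fun x : ℝ => x ^ 3 - x ^ 2) (by fun_prop)
    have hm : c ∈ Set.Icc ((fun x : ℝ => x ^ 3 - x ^ 2) 1) ((fun x : ℝ => x ^ 3 - x ^ 2) (1 + c)) := by
      simp only [Set.mem_Icc]
      constructor
      · linarith
      · nlinarith [mul_nonneg hc hc, mul_nonneg hc (mul_nonneg hc hc)]
    obtain ⟨x, hx, hx2⟩ := this hm
    exact ⟨x, hx, hx2⟩
  obtain ⟨x, hx, hxe⟩ := hiv
  have hset : {y : ℝ | 0 < y ∧ y ^ 3 - y ^ 2 = c} = {x} := by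
    ext y
    simp only [Set.mem_ofPred_eq, Set.mem_singleton_iff]
    constructor
    · rintro ⟨hy, hye⟩
      have hy1 : 1 ≤ y := by
        by_contra h
        push Not at h
        nlinarith [mul_pos (mul_pos hy hy) (sub_pos.2 h)]
      have h0 : (y - x) * (y ^ 2 + x * y + x ^ 2 - y - x) = 0 := by linarith
      rcases mul_eq_zero.1 h0 with h | h
      · linarith
      · nlinarith [hx.1]
    · rintro rfl
      exact ⟨by linarith [hx.1], hxe⟩
  have : cubicRoot q t = x := by
    unfold cubicRoot
    rw [← hcdef, hset, csSup_singleton]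
  rw [this]
  exact ⟨hx.1, hxe⟩

/-- positive eigenvector of the transfer matrix -/
lemma exists_eigenvector (p : ZMod 3 → ℝ) (hp : ∀ i, 0 < p i) (hsum : p 0 + p 1 + p 2 = 1)
    (t : ℝ) : ∃ W : ZMod 3 → ℝ, (∀ i, 0 < W i) ∧ ∀ i,
      ∑ j, p j * Real.exp (t * ((j - i).repInt : ℝ)) * W j =
        cubicRoot (p 0 * p 1 * p 2) t * W i := by
  have h0 := hp 0
  have h1 := hp 1
  have h2 := hp 2
  obtain ⟨hx1, hx⟩ := cubicRoot_spec (p 0 * p 1 * p 2) t (by positivity)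
  set x := cubicRoot (p 0 * p 1 * p 2) t
  have ha := Real.exp_pos t
  have hb := Real.exp_pos (-t)
  have hab : Real.exp t * Real.exp (-t) = 1 := by rw [← Real.exp_add]; simp
  have ha3 : Real.exp (3 * t) = Real.exp t ^ 3 := by
    rw [← Real.exp_nat_mul]; norm_num
  have hb3 : Real.exp (-(3 * t)) = Real.exp (-t) ^ 3 := by
    rw [← Real.exp_nat_mul]; congr 1; push_cast; ring
  rw [ha3, hb3] at hx
  have r0 : (0 : ZMod 3).repInt = 0 := by simp [ZMod.repInt]
  have r1 : (1 : ZMod 3).repInt = 1 := by simp [ZMod.repInt]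
  have r2 : (2 : ZMod 3).repInt = -1 := by
    have e1 : (2 : ZMod 3) ≠ 0 := by decide
    have e2 : (2 : ZMod 3) ≠ 1 := by decide
    simp [ZMod.repInt, e1, e2]
  have d1 : (0 - 1 : ZMod 3) = 2 := by decide
  have d2 : (0 - 2 : ZMod 3) = 1 := by decide
  have d3 : (1 - 2 : ZMod 3) = 2 := by decide
  have d4 : (2 - 1 : ZMod 3) = 1 := by decide
  have sum3 : ∀ f : ZMod 3 → ℝ, ∑ j, f j = f 0 + f 1 + f 2 := fun f => Fin.sum_univ_three f
  have all3 : ∀ P : ZMod 3 → Prop, P 0 → P 1 → P 2 → ∀ i, P i := by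
    intro P h0 h1 h2 i
    fin_cases i
    · exact h0
    · exact h1
    · exact h2
  generalize hA : Real.exp t = a at *
  generalize hB : Real.exp (-t) = b at *
  have e2 : (2 : ZMod 3) ≠ 0 := by decide
  have e3 : (2 : ZMod 3) ≠ 1 := by decide
  obtain ⟨W, w0, w1, w2⟩ : ∃ W : ZMod 3 → ℝ, W 0 = x * (x - p 1 - p 2) ∧
      W 1 = p 0 * (b * (x - p 2) + p 2 * a ^ 2) ∧ W 2 = p 0 * (a * (x - p 1) + p 1 * b ^ 2) :=
    ⟨fun i => if i = 0 then x * (x - p 1 - p 2) else if i = 1 then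
      p 0 * (b * (x - p 2) + p 2 * a ^ 2) else p 0 * (a * (x - p 1) + p 1 * b ^ 2),
      by simp, by simp, by simp [e2, e3]⟩
  have x1 : 0 < x - p 1 := by linarith
  have x2 : 0 < x - p 2 := by linarith
  have x12 : 0 < x - p 1 - p 2 := by linarith
  have x0 : 0 < x := by linarith
  refine ⟨W, all3 _ ?_ ?_ ?_, all3 _ ?_ ?_ ?_⟩
  · rw [w0]; positivity
  · rw [w1]; positivity
  · rw [w2]; positivity
  · rw [sum3]
    simp only [sub_zero, r0, r1, r2, Int.cast_zero, Int.cast_one, Int.cast_neg, mul_zero,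
      Real.exp_zero, mul_one, mul_neg, hA, hB, w0, w1, w2]
    linear_combination p 0 * (p 1 * (x - p 2) + p 2 * (x - p 1)) * hab + x ^ 2 * hsum - hx
  · rw [sum3]
    simp only [sub_self, d1, d4, r0, r1, r2, Int.cast_zero, Int.cast_one, Int.cast_neg, mul_zero,
      Real.exp_zero, mul_one, mul_neg, hA, hB, w0, w1, w2]
    linear_combination p 0 * p 1 * p 2 * b * hab
  · rw [sum3]
    simp only [sub_self, d2, d3, r0, r1, r2, Int.cast_zero, Int.cast_one, Int.cast_neg, mul_zero,
      Real.exp_zero, mul_one, mul_neg, hA, hB, w0, w1, w2]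
    linear_combination p 0 * p 1 * p 2 * a * hab

def cyl (s : Finset V) (κ : V → ZMod 3) : Set (V → ZMod 3) := {ω | ∀ u ∈ s, ω u = κ u}

lemma measurableSet_cyl (s : Finset V) (κ : V → ZMod 3) : MeasurableSet (cyl s κ) := by
  have : cyl s κ = ⋂ u ∈ s, (fun ω : V → ZMod 3 => ω u) ⁻¹' {κ u} := by
    ext ω; simp [cyl]
  rw [this]
  exact s.measurableSet_biInter (fun u _ => measurable_pi_apply u (MeasurableSpace.measurableSet_top))

lemma cyl_insert (s : Finset V) (κ : V → ZMod 3) (z : V) (hz : z ∉ s) :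
    cyl s κ = ⋃ j : ZMod 3, cyl (insert z s) (Function.update κ z j) := by
  ext ω
  simp only [cyl, Set.mem_iUnion, Set.mem_ofPred_eq, Finset.mem_insert, forall_eq_or_imp,
    Function.update_self]
  constructor
  · intro h
    refine ⟨ω z, rfl, fun u hu => ?_⟩
    rw [Function.update_of_ne (by rintro rfl; exact hz hu)]
    exact h u hu
  · rintro ⟨j, -, h⟩ u hu
    have := h u hu
    rwa [Function.update_of_ne (by rintro rfl; exact hz hu)] at this

lemma cyl_disjoint (s : Finset V) (κ : V → ZMod 3) (z : V) :
    Pairwise (Function.onFun Disjoint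
      (fun j : ZMod 3 => cyl (insert z s) (Function.update κ z j))) := by
  intro i j hij
  rw [Function.onFun, Set.disjoint_left]
  intro ω h1 h2
  have a1 := h1 z (by simp)
  have a2 := h2 z (by simp)
  simp only [Function.update_self] at a1 a2
  exact hij (a1.symm.trans a2)

lemma lintegral_walk (G : SimpleGraph V)
    (p : ZMod 3 → ℝ) (hp : ∀ i, 0 < p i)
    (μ : Measure (V → ZMod 3))
    (hμ : ∀ (s : Finset V) (κ : V → ZMod 3),
      μ (cyl s κ) = ∏ u ∈ s, ENNReal.ofReal (p (κ u)))
    (t x : ℝ) (hx : 0 ≤ x) (W : ZMod 3 → ℝ) (hW : ∀ i, 0 < W i)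
    (heig : ∀ i, ∑ j, p j * Real.exp (t * ((j - i).repInt : ℝ)) * W j = x * W i)
    {a b : V} (w : G.Walk a b) (hw : w.IsPath) : ∀ (s : Finset V) (κ : V → ZMod 3),
      a ∈ s → (∀ v ∈ w.support.tail, v ∉ s) →
      ∫⁻ ω in cyl s κ, ENNReal.ofReal (Real.exp (t * (walkIntCCA ω w : ℝ)) * W (ω b)) ∂μ =
        μ (cyl s κ) * ENNReal.ofReal (x ^ w.length * W (κ a)) := by
  induction w with
  | @nil a =>
    intro s κ ha _
    rw [setLIntegral_congr_fun (g := fun _ => ENNReal.ofReal (W (κ a))) (measurableSet_cyl s κ)]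
    · simp [mul_comm]
    · intro ω hω
      simp [walkIntCCA_nil, hω a ha]
  | @cons a z b h w ih =>
    intro s κ ha hs
    rw [SimpleGraph.Walk.cons_isPath_iff] at hw
    rw [SimpleGraph.Walk.support_cons, List.tail_cons] at hs
    have hz : z ∉ s := hs z w.start_mem_support
    have haz : a ≠ z := fun e => hz (e ▸ ha)
    have hnd : z ∉ w.support.tail := by
      have := hw.1.support_nodup
      rw [← SimpleGraph.Walk.cons_tail_support] at this
      exact (List.nodup_cons.1 this).1
    have hmu : ∀ j, μ (cyl (insert z s) (Function.update κ z j)) =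
        ENNReal.ofReal (p j) * μ (cyl s κ) := by
      intro j
      rw [hμ, hμ, Finset.prod_insert hz, Function.update_self]
      congr 1
      refine Finset.prod_congr rfl fun u hu => ?_
      rw [Function.update_of_ne (by rintro rfl; exact hz hu)]
    have key : ∀ j, ∫⁻ ω in cyl (insert z s) (Function.update κ z j),
        ENNReal.ofReal (Real.exp (t * (walkIntCCA ω (SimpleGraph.Walk.cons h w) : ℝ)) * W (ω b)) ∂μ
        = μ (cyl s κ) * ENNReal.ofReal
          (x ^ w.length * (p j * Real.exp (t * ((j - κ a).repInt : ℝ)) * W j)) := by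
      intro j
      rw [setLIntegral_congr_fun (g := fun ω => ENNReal.ofReal
        (Real.exp (t * ((j - κ a).repInt : ℝ))) *
        ENNReal.ofReal (Real.exp (t * (walkIntCCA ω w : ℝ)) * W (ω b))) (measurableSet_cyl _ _)]
      · rw [lintegral_const_mul' _ _ ENNReal.ofReal_ne_top, ih hw.1 _ _ (by simp), hmu,
          Function.update_self]
        · rw [mul_comm (ENNReal.ofReal (p j)), mul_assoc, mul_left_comm]
          congr 1
          rw [← ENNReal.ofReal_mul (hp j).le, ← ENNReal.ofReal_mul (Real.exp_pos _).le]
          congr 1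
          ring
        · intro v hv
          rw [Finset.mem_insert, not_or]
          exact ⟨fun e => hnd (e ▸ hv), hs v (List.mem_of_mem_tail hv)⟩
      · intro ω hω
        have e1 : ω z = j := by simpa using hω z (by simp)
        have e2 : ω a = κ a := by simpa [haz] using hω a (by simp [ha])
        simp only
        rw [← ENNReal.ofReal_mul (Real.exp_pos _).le, walkIntCCA_cons, e1, e2, Int.cast_add,
          mul_add, Real.exp_add, mul_assoc]
    rw [cyl_insert s κ z hz, lintegral_iUnion (fun j => measurableSet_cyl _ _)
      (cyl_disjoint s κ z), ← cyl_insert s κ z hz, tsum_fintype]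
    simp_rw [key]
    rw [← Finset.mul_sum, ← ENNReal.ofReal_sum_of_nonneg, ← Finset.mul_sum, heig,
      SimpleGraph.Walk.length_cons]
    · congr 2
      ring
    · intro j _
      have := hp j
      have := hW j
      positivity

lemma measurable_walkInt (G : SimpleGraph V) {a b : V} (w : G.Walk a b) :
    Measurable (fun ω : V → ZMod 3 => walkIntCCA ω w) := by
  induction w with
  | nil => simp only [walkIntCCA_nil]; exact measurable_const
  | @cons a z b h w ih =>
    simp only [walkIntCCA_cons]
    refine Measurable.add ?_ ih
    have h1 : Measurable (fun q : ZMod 3 × ZMod 3 => (q.1 - q.2).repInt) :=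
      measurable_of_countable _
    have h2 : Measurable (fun ω : V → ZMod 3 => (ω z, ω a)) :=
      (measurable_pi_apply z).prodMk (measurable_pi_apply a)
    exact h1.comp h2

lemma chernoff (G : SimpleGraph V)
    (p : ZMod 3 → ℝ) (hp : ∀ i, 0 < p i) (hsum : p 0 + p 1 + p 2 = 1)
    (μ : Measure (V → ZMod 3)) [IsProbabilityMeasure μ]
    (hμ : ∀ (s : Finset V) (κ : V → ZMod 3),
      μ {ω : V → ZMod 3 | ∀ u ∈ s, ω u = κ u} = ∏ u ∈ s, ENNReal.ofReal (p (κ u)))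
    (t : ℝ) (ht : 0 ≤ t) : ∃ C : ℝ, 0 ≤ C ∧ ∀ {a b : V} (w : G.Walk a b), w.IsPath → ∀ y : ℝ,
      μ {ω | y ≤ (walkIntCCA ω w : ℝ)} ≤
        ENNReal.ofReal (C * (cubicRoot (p 0 * p 1 * p 2) t ^ w.length * Real.exp (-(t * y)))) := by
  obtain ⟨W, hW, heig⟩ := exists_eigenvector p hp hsum t
  obtain ⟨hx1, -⟩ := cubicRoot_spec (p 0 * p 1 * p 2) t
    (mul_pos (mul_pos (hp 0) (hp 1)) (hp 2))
  set x := cubicRoot (p 0 * p 1 * p 2) t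
  obtain ⟨i0, hi0⟩ := Finite.exists_min W
  obtain ⟨i1, hi1⟩ := Finite.exists_max W
  have hWi0 := hW i0
  have hWi1 := hW i1
  refine ⟨W i1 / W i0, by positivity, ?_⟩
  intro a b w hw y
  -- total integral
  have hint : ∫⁻ ω, ENNReal.ofReal (Real.exp (t * (walkIntCCA ω w : ℝ)) * W (ω b)) ∂μ ≤
      ENNReal.ofReal (x ^ w.length * W i1) := by
    have hnd : a ∉ w.support.tail := by
      have := hw.support_nodup
      rw [← SimpleGraph.Walk.cons_tail_support] at this
      exact (List.nodup_cons.1 this).1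
    have huniv : (Set.univ : Set (V → ZMod 3)) =
        ⋃ j : ZMod 3, cyl (insert a ∅) (Function.update (fun _ => 0) a j) := by
      rw [← cyl_insert ∅ (fun _ => 0) a (by simp)]
      simp [cyl]
    have hone : ∑ j : ZMod 3, μ (cyl (insert a ∅) (Function.update (fun _ => 0) a j)) = 1 := by
      have := measure_iUnion (μ := μ) (cyl_disjoint ∅ (fun _ => 0) a)
        (fun j => measurableSet_cyl _ _)
      rw [← huniv, measure_univ, tsum_fintype] at this
      exact this.symm
    rw [← setLIntegral_univ, huniv, lintegral_iUnion (fun j => measurableSet_cyl _ _)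
      (cyl_disjoint ∅ (fun _ => 0) a), tsum_fintype]
    calc _ ≤ ∑ j : ZMod 3, μ (cyl (insert a ∅) (Function.update (fun _ => 0) a j)) *
          ENNReal.ofReal (x ^ w.length * W i1) := by
          refine Finset.sum_le_sum fun j _ => ?_
          rw [lintegral_walk G p hp μ hμ t x (by linarith) W hW heig w hw _ _ (by simp)]
          · gcongr
            exact hi1 _
          · intro v hv
            simp only [insert_empty_eq, Finset.mem_singleton]
            exact fun e => hnd (e ▸ hv)
      _ = _ := by rw [← Finset.sum_mul, hone, one_mul]
  have hmeas : Measurable (fun ω : V → ZMod 3 =>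
      ENNReal.ofReal (Real.exp (t * (walkIntCCA ω w : ℝ)) * W (ω b))) := by
    have h1 := measurable_walkInt G w
    have h2 : Measurable (fun ω : V → ZMod 3 => W (ω b)) :=
      (measurable_of_countable W).comp (measurable_pi_apply b)
    have h3 : Measurable (fun ω : V → ZMod 3 => (walkIntCCA ω w : ℝ)) :=
      (measurable_of_countable (fun n : ℤ => (n : ℝ))).comp h1
    fun_prop
  have hmk := mul_meas_ge_le_lintegral (μ := μ) hmeas (ENNReal.ofReal (Real.exp (t * y) * W i0))
  have hpos : 0 < Real.exp (t * y) * W i0 := by positivity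
  have hsub : μ {ω | y ≤ (walkIntCCA ω w : ℝ)} ≤ μ {ω | ENNReal.ofReal (Real.exp (t * y) * W i0) ≤
      ENNReal.ofReal (Real.exp (t * (walkIntCCA ω w : ℝ)) * W (ω b))} := by
    refine measure_mono ?_
    intro ω hω
    simp only [Set.mem_ofPred_eq] at hω ⊢
    gcongr
    exact hi0 _
  have hfin : ENNReal.ofReal (Real.exp (t * y) * W i0) * μ {ω | y ≤ (walkIntCCA ω w : ℝ)} ≤
      ENNReal.ofReal (x ^ w.length * W i1) := by
    refine le_trans ?_ (hmk.trans hint)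
    gcongr
  have hne : ENNReal.ofReal (Real.exp (t * y) * W i0) ≠ 0 := by
    rw [Ne, ENNReal.ofReal_eq_zero]; linarith
  rw [mul_comm, ← ENNReal.le_div_iff_mul_le (Or.inl hne) (Or.inl ENNReal.ofReal_ne_top),
    ← ENNReal.ofReal_div_of_pos hpos] at hfin
  refine hfin.trans (le_of_eq ?_)
  congr 1
  rw [Real.exp_neg]
  field_simp

lemma survivors_bound (G : SimpleGraph V) (hc : G.Connected)
    (hlf : ∀ v : V, (G.neighborSet v).Finite) (r : V)
    (p : ZMod 3 → ℝ) (hp : ∀ i, 0 < p i) (hsum : p 0 + p 1 + p 2 = 1)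
    (μ : Measure (V → ZMod 3)) [IsProbabilityMeasure μ]
    (hμ : ∀ (s : Finset V) (κ : V → ZMod 3),
      μ {ω : V → ZMod 3 | ∀ u ∈ s, ω u = κ u} = ∏ u ∈ s, ENNReal.ofReal (p (κ u)))
    (S : (V → ZMod 3) → V → ℤ)
    (hS : ∀ (ω : V → ZMod 3) (σ : V) (q : G.Walk r σ), q.IsPath →
      S ω σ = walkIntCCA ω q)
    (t u L ρ : ℝ) (ht : 0 ≤ t) (hL : L < u * t - LambdaCCA (p 0 * p 1 * p 2) t)
    (hρ : rVolumeEntropy G r ρ < (L : EReal)) :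
    ∀ᵐ ω ∂μ, ∀ᶠ n : ℕ in atTop, ∀ σ τ : V, G.dist r σ = n → IsDesc G r σ τ →
      G.dist r τ = ⌊ρ * n⌋₊ → (S ω σ : ℝ) < u * n := by
  obtain ⟨C, hC0, hC⟩ := chernoff G p hp hsum μ hμ t ht
  obtain ⟨hx1, -⟩ := cubicRoot_spec (p 0 * p 1 * p 2) t
    (mul_pos (mul_pos (hp 0) (hp 1)) (hp 2))
  unfold LambdaCCA at hL
  set x := cubicRoot (p 0 * p 1 * p 2) t
  have hx0 : 0 < x := by linarith
  set c := Real.exp (L + Real.log x - u * t) with hcdef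
  have hc0 : 0 < c := Real.exp_pos _
  have hc1 : c < 1 := by
    rw [hcdef, Real.exp_lt_one_iff]; linarith
  let A : ℕ → Set V := fun n =>
    {σ : V | G.dist r σ = n ∧ ∃ τ : V, IsDesc G r σ τ ∧ G.dist r τ = ⌊ρ * n⌋₊}
  have hAfin : ∀ n, (A n).Finite := fun n =>
    (level_finite G hc hlf r n).subset (fun x hx => hx.1)
  let B : ℕ → Set (V → ZMod 3) := fun n => ⋃ σ ∈ A n, {ω | u * n ≤ (S ω σ : ℝ)}
  have hB : ∀ n, μ (B n) ≤ ENNReal.ofReal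
      ((A n).ncard * (C * (x ^ n * Real.exp (-(t * (u * n)))))) := by
    intro n
    have hone : ∀ σ ∈ A n, μ {ω | u * n ≤ (S ω σ : ℝ)} ≤
        ENNReal.ofReal (C * (x ^ n * Real.exp (-(t * (u * n))))) := by
      intro σ hσ
      obtain ⟨w, hw⟩ := hc.exists_walk_length_eq_dist r σ
      have hwp := w.isPath_of_length_eq_dist hw
      have hl : w.length = n := hw.trans hσ.1
      have := hC w hwp (u * n)
      rw [hl] at this
      simp only [hS _ σ w hwp]
      exact this
    calc μ (B n) = μ (⋃ σ ∈ (hAfin n).toFinset, {ω | u * n ≤ (S ω σ : ℝ)}) := by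
          simp [B]
      _ ≤ ∑ σ ∈ (hAfin n).toFinset, μ {ω | u * n ≤ (S ω σ : ℝ)} :=
          measure_biUnion_finset_le _ _
      _ ≤ ∑ σ ∈ (hAfin n).toFinset, ENNReal.ofReal (C * (x ^ n * Real.exp (-(t * (u * n))))) :=
          Finset.sum_le_sum fun σ hσ => hone σ (by simpa using hσ)
      _ = _ := by
          rw [Finset.sum_const, nsmul_eq_mul, ENNReal.ofReal_mul (Nat.cast_nonneg (A n).ncard),
            ENNReal.ofReal_natCast, Set.ncard_eq_toFinset_card _ (hAfin n)]
  have hev : ∀ᶠ n : ℕ in atTop, ((Real.log (levelSurvivorCount G r n ⌊ρ * n⌋₊) / n : ℝ) : EReal)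
      < (L : EReal) := eventually_lt_of_limsup_lt hρ
  obtain ⟨N, hN⟩ := eventually_atTop.1 (hev.and (eventually_gt_atTop 0))
  have hB2 : ∀ n, μ (B (n + N)) ≤ ENNReal.ofReal (C * c ^ (n + N)) := by
    intro k
    obtain ⟨h1, h2⟩ := hN (k + N) (by omega)
    refine (hB (k + N)).trans (ENNReal.ofReal_le_ofReal ?_)
    generalize k + N = n at *
    have hn : (0:ℝ) < n := by exact_mod_cast h2
    rw [EReal.coe_lt_coe_iff, div_lt_iff₀ hn] at h1
    change Real.log ((A n).ncard : ℝ) < L * n at h1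
    have hA : ((A n).ncard : ℝ) ≤ Real.exp (L * n) := by
      rcases Nat.eq_zero_or_pos (A n).ncard with h | h
      · rw [h]; simp; positivity
      · exact ((Real.log_lt_iff_lt_exp (by exact_mod_cast h)).1 h1).le
    have hcn : c ^ n = Real.exp (L * n) * (x ^ n * Real.exp (-(t * (u * n)))) := by
      conv_rhs => rw [← Real.exp_log hx0]
      rw [hcdef, ← Real.exp_nat_mul, ← Real.exp_nat_mul, ← Real.exp_add, ← Real.exp_add]
      congr 1
      ring
    rw [hcn]
    calc _ ≤ Real.exp (L * n) * (C * (x ^ n * Real.exp (-(t * (u * n))))) := by gcongr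
      _ = _ := by ring
  have hsumm : ∑' n, μ (B (n + N)) ≠ ⊤ := by
    refine ne_top_of_le_ne_top ?_ (ENNReal.tsum_le_tsum hB2)
    have hs : Summable (fun n : ℕ => C * c ^ (n + N)) :=
      ((summable_nat_add_iff N).2 (summable_geometric_of_lt_one hc0.le hc1)).mul_left C
    rw [← ENNReal.ofReal_tsum_of_nonneg (fun n => by positivity) hs]
    exact ENNReal.ofReal_ne_top
  filter_upwards [ae_eventually_notMem hsumm] with ω hω
  obtain ⟨M, hM⟩ := eventually_atTop.1 hω
  refine eventually_atTop.2 ⟨M + N, fun n hn σ τ h1 h2 h3 => ?_⟩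
  have := hM (n - N) (by omega)
  rw [Nat.sub_add_cancel (by omega)] at this
  by_contra hcon
  push Not at hcon
  apply this
  simp only [B, Set.mem_iUnion]
  exact ⟨σ, ⟨h1, τ, h2, h3⟩, hcon⟩

lemma cloudSpeed_le (G : SimpleGraph V) (hc : G.Connected) (r : V) (ω : V → ZMod 3)
    (S : V → ℤ) (hS : ∀ (σ : V) (q : G.Walk r σ), q.IsPath → S σ = walkIntCCA ω q)
    (u u' ρ : ℝ) (hu : 0 < u) (hρ : 1 < ρ) (hρu : u + 2 * (ρ - 1) ≤ u')
    (hev : ∀ᶠ n : ℕ in atTop, ∀ σ τ : V, G.dist r σ = n → IsDesc G r σ τ →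
      G.dist r τ = ⌊ρ * n⌋₊ → (S σ : ℝ) < u * n) :
    cloudSpeed G r S ≤ u' := by
  have hSb : ∀ σ, -(G.dist r σ : ℤ) ≤ S σ ∧ S σ ≤ G.dist r σ := by
    intro σ
    obtain ⟨w, hw⟩ := hc.exists_walk_length_eq_dist r σ
    rw [hS σ w (w.isPath_of_length_eq_dist hw), ← hw]
    exact walkIntCCA_bound ω w
  have hbdd : ∀ n : ℕ, BddAbove {x : ℝ | ∃ σ : V, G.dist r σ = n ∧ (S σ : ℝ) = x} := by
    intro n
    refine ⟨n, ?_⟩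
    rintro x ⟨σ, h1, rfl⟩
    have := (hSb σ).2
    rw [h1] at this
    exact_mod_cast this
  unfold cloudSpeed
  refine limsup_le_of_le ?_ ?_
  · refine IsBoundedUnder.isCoboundedUnder_le (isBoundedUnder_of ⟨-1, fun n => ?_⟩)
    rcases Nat.eq_zero_or_pos n with rfl | hn
    · simp
    have hn' : (0:ℝ) < n := by exact_mod_cast hn
    rw [le_div_iff₀ hn']
    rcases Set.eq_empty_or_nonempty {x : ℝ | ∃ σ : V, G.dist r σ = n ∧ (S σ : ℝ) = x} with h | h
    · rw [h, Real.sSup_empty]; linarith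
    · obtain ⟨x, hx⟩ := h
      refine le_trans ?_ (le_csSup (hbdd n) hx)
      obtain ⟨σ, h1, rfl⟩ := hx
      have := (hSb σ).1
      rw [h1] at this
      have h3 : (-(n:ℝ)) ≤ S σ := by exact_mod_cast this
      linarith
  · have hρ0 : 0 < ρ := by linarith
    have htend : Tendsto (fun m : ℕ => ⌊(m:ℝ) / ρ⌋₊) atTop atTop :=
      tendsto_nat_floor_atTop.comp (tendsto_natCast_atTop_atTop.atTop_div_const hρ0)
    have hlarge : ∀ᶠ m : ℕ in atTop, 1 / (ρ - 1) ≤ (m : ℝ) :=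
      tendsto_natCast_atTop_atTop.eventually_ge_atTop _
    filter_upwards [htend.eventually hev, hlarge, eventually_gt_atTop 0] with m hm hm2 hm0
    have hm' : (0:ℝ) < m := by exact_mod_cast hm0
    rw [div_le_iff₀ hm']
    rw [div_le_iff₀ (by linarith)] at hm2
    have hu' : 0 ≤ u' := by linarith
    refine Real.sSup_le ?_ (by positivity)
    rintro _ ⟨τ, hτ, rfl⟩
    set n := ⌊(m:ℝ) / ρ⌋₊ with hn
    have hn1 : (n:ℝ) ≤ m / ρ := Nat.floor_le (by positivity)
    have hn2 : (m:ℝ) / ρ < n + 1 := Nat.lt_floor_add_one _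
    have hn3 : ρ * n ≤ m := by rw [le_div_iff₀ hρ0] at hn1; linarith
    set k := ⌊ρ * n⌋₊ with hk
    have hkm : k ≤ m := by
      have : (k:ℝ) ≤ m := (Nat.floor_le (by positivity)).trans hn3
      exact_mod_cast this
    have hnk : n ≤ k := Nat.le_floor (by nlinarith [(Nat.cast_nonneg n : (0:ℝ) ≤ n)])
    obtain ⟨τ', a1, a2, a3⟩ := exists_ancestor G hc r τ k (by omega)
    obtain ⟨σ, b1, b2, b3⟩ := exists_ancestor G hc r τ' n (by omega)
    have hlt := hm σ τ' b1 b2 a1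
    have c1 := a3 S ω hS
    have c2 := b3 S ω hS
    rw [a1] at c2
    rw [hτ] at c1
    have c3 : S τ ≤ S σ + ((m:ℤ) - n) := by omega
    have c4 : (S τ : ℝ) ≤ S σ + ((m:ℝ) - n) := by exact_mod_cast c3
    have c5 : (n:ℝ) ≤ m := by exact_mod_cast hnk.trans hkm
    have c6 : u * n ≤ u * m := by gcongr
    have c7 : (m:ℝ) - m / ρ ≤ (ρ - 1) * m := by
      have : (m:ℝ) = m / ρ * ρ := by field_simp
      have h0 : 0 ≤ (m:ℝ) / ρ := by positivity
      nlinarith [mul_nonneg h0 (sq_nonneg (ρ - 1))]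
    nlinarith

/-- Upper bound on the cloud speed of the CCA tree-indexed walk: almost surely,
`Λ*_CCA(v_c) ≤ h̄(Γ)`. -/
theorem cca_cloud_speed_upper_bound [Infinite V] (G : SimpleGraph V) (htree : G.IsTree)
    (hlf : ∀ v : V, (G.neighborSet v).Finite) (r : V)
    (p : ZMod 3 → ℝ) (hp : ∀ i, 0 < p i) (hsum : p 0 + p 1 + p 2 = 1)
    (μ : Measure (V → ZMod 3)) [IsProbabilityMeasure μ]
    (hμ : ∀ (s : Finset V) (κ : V → ZMod 3),
      μ {ω : V → ZMod 3 | ∀ u ∈ s, ω u = κ u} = ∏ u ∈ s, ENNReal.ofReal (p (κ u)))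
    (S : (V → ZMod 3) → V → ℤ)
    (hS : ∀ (ω : V → ZMod 3) (σ : V) (q : G.Walk r σ), q.IsPath →
      S ω σ = walkIntCCA ω q) :
    ∀ᵐ ω ∂μ,
      LstarCCA (p 0 * p 1 * p 2) (cloudSpeed G r (S ω)) ≤ reducedVolumeEntropy G r := by
  have hc := htree.connected
  have hmain : ∀ u u' : ℚ, u < u' → (∃ t : ℝ, 0 < t ∧
      reducedVolumeEntropy G r < ((u * t - LambdaCCA (p 0 * p 1 * p 2) t : ℝ) : EReal)) →
      ∀ᵐ ω ∂μ, cloudSpeed G r (S ω) ≤ u' := by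
    rintro u u' huu' ⟨t, ht, htu⟩
    have huu : (u : ℝ) < u' := by exact_mod_cast huu'
    obtain ⟨hx1, -⟩ := cubicRoot_spec (p 0 * p 1 * p 2) t
      (mul_pos (mul_pos (hp 0) (hp 1)) (hp 2))
    have hΛ : 0 ≤ LambdaCCA (p 0 * p 1 * p 2) t := Real.log_nonneg hx1
    have hu : (0:ℝ) < u := by
      have h := (entropy_nonneg G r).trans_lt htu
      have h2 : (0:ℝ) < u * t - LambdaCCA (p 0 * p 1 * p 2) t := by exact_mod_cast h
      have h3 : 0 < (u:ℝ) * t := by linarith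
      exact pos_of_mul_pos_left h3 ht.le
    obtain ⟨L, hL1, hL2⟩ := EReal.lt_iff_exists_real_btwn.1 htu
    have hL2' : L < u * t - LambdaCCA (p 0 * p 1 * p 2) t := by exact_mod_cast hL2
    have he : ∀ᶠ ρ in nhdsWithin 1 (Set.Ioi (1 : ℝ)), rVolumeEntropy G r ρ < (L : EReal) :=
      eventually_lt_of_limsup_lt hL1
    have he2 : ∀ᶠ ρ : ℝ in nhdsWithin 1 (Set.Ioi (1 : ℝ)), ρ < 1 + ((u' : ℝ) - u) / 2 :=
      nhdsWithin_le_nhds (eventually_lt_nhds (by linarith))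
    obtain ⟨ρ, h1, h2, h3⟩ := (he.and (he2.and self_mem_nhdsWithin)).exists
    filter_upwards [survivors_bound G hc hlf r p hp hsum μ hμ S hS t u L ρ ht.le hL2' h1] with ω hω
    exact cloudSpeed_le G hc r ω (S ω) (hS ω) u u' ρ hu h3 (by linarith) hω
  have hall : ∀ᵐ ω ∂μ, ∀ u u' : ℚ, u < u' → (∃ t : ℝ, 0 < t ∧
      reducedVolumeEntropy G r < ((u * t - LambdaCCA (p 0 * p 1 * p 2) t : ℝ) : EReal)) →
      cloudSpeed G r (S ω) ≤ u' := by
    simp only [ae_all_iff]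
    intro u u' h1 h2
    exact hmain u u' h1 h2
  filter_upwards [hall] with ω hω
  unfold LstarCCA
  refine iSup_le ?_
  rintro ⟨t, ht⟩
  simp only [Set.mem_Ici] at ht
  by_contra hcon
  push Not at hcon
  simp only at hcon
  set v := cloudSpeed G r (S ω)
  obtain ⟨hx1, -⟩ := cubicRoot_spec (p 0 * p 1 * p 2) t
    (mul_pos (mul_pos (hp 0) (hp 1)) (hp 2))
  have hΛ : 0 ≤ LambdaCCA (p 0 * p 1 * p 2) t := Real.log_nonneg hx1
  have hpos : 0 < t := by
    rcases ht.eq_or_lt with h | h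
    · exfalso
      have h2 := (entropy_nonneg G r).trans_lt hcon
      have h3 : (0:ℝ) < v * t - LambdaCCA (p 0 * p 1 * p 2) t := by exact_mod_cast h2
      rw [← h] at h3 hΛ
      linarith
    · exact h
  obtain ⟨L, hL1, hL2⟩ := EReal.lt_iff_exists_real_btwn.1 hcon
  have hL2' : L < v * t - LambdaCCA (p 0 * p 1 * p 2) t := by exact_mod_cast hL2
  have hlt : (L + LambdaCCA (p 0 * p 1 * p 2) t) / t < v := by
    rw [div_lt_iff₀ hpos]; linarith
  obtain ⟨u, hu1, hu2⟩ := exists_rat_btwn hlt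
  obtain ⟨u', hu3, hu4⟩ := exists_rat_btwn hu2
  rw [div_lt_iff₀ hpos] at hu1
  have := hω u u' (by exact_mod_cast hu3) ⟨t, hpos, hL1.trans (by
    rw [EReal.coe_lt_coe_iff]; linarith)⟩
  linarith
end
end
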